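/- Let L₁ be any one of the unimodal logics Log⟨ω,<⟩, GL.3, or DisK4.3. Then for any Kripke complete bimodal logic L with [L₁, Diff] ⊆ L ⊆ L₁ × Diff, the L-satisfiability problem (given a bimodal formula φ, is there a model M with M ⊨ L in which φ is satisfied) is Σ₁¹-hard. -/

import Mathlib

namespace HK

/-! ## Bimodal formulas -/

/-- Bimodal formulas: `φ ::= P | ¬φ | φ∧ψ | ◇₀φ | ◇₁φ`. -/
inductive BForm : Type
  | var : ℕ → BForm
  | neg : BForm → BForm
  | and : BForm → BForm → BForm
  | dia0 : BForm → BForm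
  | dia1 : BForm → BForm

namespace BForm

def imp (φ ψ : BForm) : BForm := neg (and φ (neg ψ))
def bot : BForm := and (var 0) (neg (var 0))
def top : BForm := neg bot
def box0 (φ : BForm) : BForm := neg (dia0 (neg φ))
def box1 (φ : BForm) : BForm := neg (dia1 (neg φ))
/-- `□₀⁺φ := φ ∧ □₀φ` -/
def boxP0 (φ : BForm) : BForm := and φ (box0 φ)
/-- `□₁⁺φ := φ ∧ □₁φ` -/
def boxP1 (φ : BForm) : BForm := and φ (box1 φ)

/-- Modal nesting depth. -/
def depth : BForm → ℕ
  | var _ => 0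
  | neg φ => depth φ
  | and φ ψ => max (depth φ) (depth ψ)
  | dia0 φ => depth φ + 1
  | dia1 φ => depth φ + 1

/-- The propositional variable `k` occurs in the formula. -/
def Occurs (k : ℕ) : BForm → Prop
  | var n => k = n
  | neg φ => Occurs k φ
  | and φ ψ => Occurs k φ ∨ Occurs k ψ
  | dia0 φ => Occurs k φ
  | dia1 φ => Occurs k φ

/-- The formula uses only the modal operator `◇₀`. -/
def OnlyDia0 : BForm → Prop
  | var _ => True
  | neg φ => OnlyDia0 φ
  | and φ ψ => OnlyDia0 φ ∧ OnlyDia0 ψ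
  | dia0 φ => OnlyDia0 φ
  | dia1 _ => False

/-- The formula uses only the modal operator `◇₁`. -/
def OnlyDia1 : BForm → Prop
  | var _ => True
  | neg φ => OnlyDia1 φ
  | and φ ψ => OnlyDia1 φ ∧ OnlyDia1 ψ
  | dia0 _ => False
  | dia1 φ => OnlyDia1 φ

/-- Relativisation `φ^D` of each diamond to the variable `d`:
each subformula `◇ᵢψ` is replaced by `◇ᵢ(D ∧ ψ^D)`. -/
def relativize (d : ℕ) : BForm → BForm
  | var n => var n
  | neg φ => neg (relativize d φ)
  | and φ ψ => and (relativize d φ) (relativize d ψ)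
  | dia0 φ => dia0 (and (var d) (relativize d φ))
  | dia1 φ => dia1 (and (var d) (relativize d φ))

/-- `□₀^k φ` -/
def iterBox0 : ℕ → BForm → BForm
  | 0, φ => φ
  | n+1, φ => box0 (iterBox0 n φ)

/-- `□₁^k φ` -/
def iterBox1 : ℕ → BForm → BForm
  | 0, φ => φ
  | n+1, φ => box1 (iterBox1 n φ)

/-- `□₀^{≤n} φ := ⋀_{k ≤ n} □₀^k φ` -/
def boxLe0 : ℕ → BForm → BForm
  | 0, φ => φ
  | n+1, φ => and (boxLe0 n φ) (iterBox0 (n+1) φ)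

/-- `□₁^{≤n} φ := ⋀_{k ≤ n} □₁^k φ` -/
def boxLe1 : ℕ → BForm → BForm
  | 0, φ => φ
  | n+1, φ => and (boxLe1 n φ) (iterBox1 (n+1) φ)

/-- Uniform substitution. -/
def subst (s : ℕ → BForm) : BForm → BForm
  | var n => s n
  | neg φ => neg (subst s φ)
  | and φ ψ => and (subst s φ) (subst s ψ)
  | dia0 φ => dia0 (subst s φ)
  | dia1 φ => dia1 (subst s φ)

end BForm

/-- Kripke truth over a 2-frame `⟨W, R0, R1⟩` with valuation `val`. -/
def BSat {W : Type} (R0 R1 : W → W → Prop) (val : ℕ → W → Prop) : W → BForm → Prop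
  | w, .var n => val n w
  | w, .neg φ => ¬ BSat R0 R1 val w φ
  | w, .and φ ψ => BSat R0 R1 val w φ ∧ BSat R0 R1 val w ψ
  | w, .dia0 φ => ∃ v, R0 w v ∧ BSat R0 R1 val v φ
  | w, .dia1 φ => ∃ v, R1 w v ∧ BSat R0 R1 val v φ

/-! ## Frames -/

/-- A (unimodal) frame: a nonempty set with a binary relation. -/
structure Frame : Type 1 where
  W : Type
  R : W → W → Prop
  ne : Nonempty W

/-- A 2-frame: a nonempty set with two binary relations. -/
structure Frame2 : Type 1 where
  W : Type
  R0 : W → W → Prop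
  R1 : W → W → Prop
  ne : Nonempty W

/-- Validity of a bimodal formula in a 2-frame. -/
def Frame2.Valid (F : Frame2) (φ : BForm) : Prop :=
  ∀ (val : ℕ → F.W → Prop) (w : F.W), BSat F.R0 F.R1 val w φ

/-- Satisfaction of a bimodal formula in some model based on the 2-frame. -/
def Frame2.Sat (F : Frame2) (φ : BForm) : Prop :=
  ∃ (val : ℕ → F.W → Prop) (w : F.W), BSat F.R0 F.R1 val w φ

/-- Horizontal relation of a product frame. -/
def prodR0 {A B : Type} (R : A → A → Prop) : A × B → A × B → Prop :=
  fun p q => R p.1 q.1 ∧ p.2 = q.2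

/-- Vertical relation of a product frame. -/
def prodR1 {A B : Type} (S : B → B → Prop) : A × B → A × B → Prop :=
  fun p q => p.1 = q.1 ∧ S p.2 q.2

/-- `φ` is satisfied in some model based on the product frame `⟨A,R⟩ × ⟨B,S⟩`. -/
def ProdSat {A B : Type} (R : A → A → Prop) (S : B → B → Prop) (φ : BForm) : Prop :=
  ∃ (val : ℕ → A × B → Prop) (w : A × B), BSat (prodR0 R) (prodR1 S) val w φ

/-- `φ` is valid in the product frame `⟨A,R⟩ × ⟨B,S⟩`. -/
def ProdValid {A B : Type} (R : A → A → Prop) (S : B → B → Prop) (φ : BForm) : Prop :=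
  ∀ (val : ℕ → A × B → Prop) (w : A × B), BSat (prodR0 R) (prodR1 S) val w φ

/-- The product 2-frame of two frames. -/
def prodFrame2 (A B : Type) [Nonempty A] [Nonempty B]
    (R : A → A → Prop) (S : B → B → Prop) : Frame2 :=
  ⟨A × B, prodR0 R, prodR1 S, inferInstance⟩

/-- Linear order: irreflexive, transitive and trichotomous. -/
def IsLin {T : Type} (R : T → T → Prop) : Prop :=
  (∀ x, ¬ R x x) ∧ (∀ x y z, R x y → R y z → R x z) ∧ (∀ x y, R x y ∨ x = y ∨ R y x)

/-- Weak order: transitive and weakly connected. -/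
def WeakOrd {T : Type} (R : T → T → Prop) : Prop :=
  (∀ x y z, R x y → R y z → R x z) ∧ (∀ x y z, R x y → R x z → y = z ∨ R y z ∨ R z y)

/-- Modal discreteness. -/
def ModallyDiscrete {T : Type} (R : T → T → Prop) : Prop :=
  ¬ ∃ (x : ℕ → T) (xω : T), (∀ i, R (x i) (x (i+1))) ∧ (∀ i, x i ≠ x (i+1)) ∧
      (∀ i, R (x i) xω) ∧ (∀ i, ¬ R xω (x i))

/-- No infinite ascending chains of distinct points. -/
def Noetherian {T : Type} (R : T → T → Prop) : Prop :=
  ¬ ∃ x : ℕ → T, (∀ i, R (x i) (x (i+1))) ∧ (∀ i, x i ≠ x (i+1))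

/-- The frame is (isomorphic to) `⟨ω,<⟩`. -/
def IsOmegaFrame (F : Frame) : Prop :=
  ∃ e : F.W ≃ ℕ, ∀ a b, F.R a b ↔ e a < e b

/-- The frame is a finite linear order. -/
def IsFinLinFrame (F : Frame) : Prop := Finite F.W ∧ IsLin F.R

/-- `F` contains an `⟨ω+1,>⟩`-type chain: distinct points `x₀,…,x_n,…,x_ω` with
`x_n R x_m` iff `n > m` (for `n ≠ m`). -/
def HasOmegaPlusOneChain (F : Frame) : Prop :=
  ∃ (x : ℕ → F.W) (xω : F.W), Function.Injective x ∧ (∀ n, x n ≠ xω) ∧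
    (∀ n m, n ≠ m → (F.R (x n) (x m) ↔ m < n)) ∧
    (∀ n, F.R xω (x n)) ∧ (∀ n, ¬ F.R (x n) xω)

/-! ## Two-dimensional (expanding/decreasing) 2-frames `H_{F,Ḡ}` -/

/-- A 2-frame `H_{F,Ḡ}` built from a horizontal frame `⟨H,R⟩` and, for each `x : H`,
a vertical frame `G_x = ⟨D x, S x⟩` carved out of a common ambient type `V`. -/
structure TwoFrame : Type 1 where
  H : Type
  R : H → H → Prop
  Hne : Nonempty H
  V : Type
  D : H → Set V
  S : H → V → V → Prop
  Dne : ∀ x, (D x).Nonempty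

namespace TwoFrame

/-- The horizontal frame. -/
def horiz (T : TwoFrame) : Frame := ⟨T.H, T.R, T.Hne⟩

/-- The vertical frame `G_x` at `x`. -/
def fiber (T : TwoFrame) (x : T.H) : Frame :=
  ⟨{a : T.V // a ∈ T.D x}, fun a b => T.S x a.1 b.1,
    Exists.elim (T.Dne x) (fun a ha => ⟨⟨a, ha⟩⟩)⟩

/-- The worlds `{⟨u,v⟩ : u ∈ H, v ∈ D u}`. -/
def Worlds (T : TwoFrame) : Type := {p : T.H × T.V // p.2 ∈ T.D p.1}

/-- Horizontal relation of `H_{F,Ḡ}`. -/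
def Rh (T : TwoFrame) : T.Worlds → T.Worlds → Prop :=
  fun p q => T.R p.1.1 q.1.1 ∧ p.1.2 = q.1.2

/-- Vertical relation of `H_{F,Ḡ}`. -/
def Rv (T : TwoFrame) : T.Worlds → T.Worlds → Prop :=
  fun p q => p.1.1 = q.1.1 ∧ T.S p.1.1 p.1.2 q.1.2

/-- `φ` is satisfied in some model based on `H_{F,Ḡ}`. -/
def Sat (T : TwoFrame) (φ : BForm) : Prop :=
  ∃ (val : ℕ → T.Worlds → Prop) (w : T.Worlds), BSat T.Rh T.Rv val w φ

/-- Decreasing 2-frame: `G_y` is a subframe of `G_x` whenever `x R y`. -/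
def Decreasing (T : TwoFrame) : Prop :=
  ∀ x y, T.R x y → T.D y ⊆ T.D x ∧ ∀ a ∈ T.D y, ∀ b ∈ T.D y, (T.S y a b ↔ T.S x a b)

/-- Expanding 2-frame: `G_x` is a subframe of `G_y` whenever `x R y`. -/
def Expanding (T : TwoFrame) : Prop :=
  ∀ x y, T.R x y → T.D x ⊆ T.D y ∧ ∀ a ∈ T.D x, ∀ b ∈ T.D x, (T.S x a b ↔ T.S y a b)

/-- All vertical frames are difference frames. -/
def DiffFibers (T : TwoFrame) : Prop :=
  ∀ x, ∀ a ∈ T.D x, ∀ b ∈ T.D x, (T.S x a b ↔ a ≠ b)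

end TwoFrame

/-- `φ` is satisfied in some model based on a product of a member of `C`
with a difference frame. -/
def ProdDiffSat (C : Frame → Prop) (φ : BForm) : Prop :=
  ∃ F : Frame, C F ∧ ∃ D : Type, Nonempty D ∧ ProdSat F.R (fun a b : D => a ≠ b) φ

/-- `φ` is satisfied in some model based on a decreasing 2-frame with horizontal
frame in `C` and all vertical frames difference frames. -/
def DecDiffSat (C : Frame → Prop) (φ : BForm) : Prop :=
  ∃ T : TwoFrame, C T.horiz ∧ T.Decreasing ∧ T.DiffFibers ∧ T.Sat φ

/-- `φ` is satisfied in some model based on an expanding 2-frame with horizontal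
frame in `C` and all vertical frames difference frames. -/
def ExpDiffSat (C : Frame → Prop) (φ : BForm) : Prop :=
  ∃ T : TwoFrame, C T.horiz ∧ T.Expanding ∧ T.DiffFibers ∧ T.Sat φ

/-- `φ` is satisfied in some model based on a product of a member of `C0` with a
member of `C1`. -/
def ProdClassSat (C0 C1 : Frame → Prop) (φ : BForm) : Prop :=
  ∃ F0, C0 F0 ∧ ∃ F1, C1 F1 ∧ ProdSat F0.R F1.R φ

/-- `φ` is satisfied in some model based on a decreasing 2-frame with horizontal
frame in `C0` and all vertical frames in `C1`. -/
def DecClassSat (C0 C1 : Frame → Prop) (φ : BForm) : Prop :=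
  ∃ T : TwoFrame, C0 T.horiz ∧ (∀ x, C1 (T.fiber x)) ∧ T.Decreasing ∧ T.Sat φ

/-- `φ` is satisfied in some model based on an expanding 2-frame with horizontal
frame in `C0` and all vertical frames in `C1`. -/
def ExpClassSat (C0 C1 : Frame → Prop) (φ : BForm) : Prop :=
  ∃ T : TwoFrame, C0 T.horiz ∧ (∀ x, C1 (T.fiber x)) ∧ T.Expanding ∧ T.Sat φ

/-- Satisfiability over products of `⟨ω,<⟩` with difference frames. -/
def OmegaDiffSat (φ : BForm) : Prop :=
  ∃ D : Type, Nonempty D ∧ ProdSat (fun m n : ℕ => m < n) (fun a b : D => a ≠ b) φ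

/-- Satisfiability over products of finite linear orders with difference frames. -/
def FinLinDiffSat (φ : BForm) : Prop :=
  ∃ (T : Type) (R : T → T → Prop), Finite T ∧ IsLin R ∧
    ∃ D : Type, Nonempty D ∧ ProdSat R (fun a b : D => a ≠ b) φ

/-! ## Bimodal logics -/

/-- Propositional tautology (diamond formulas treated as atoms). -/
def IsTaut (φ : BForm) : Prop :=
  ∀ v : BForm → Prop, (∀ ψ, v (BForm.neg ψ) ↔ ¬ v ψ) →
    (∀ ψ χ, v (BForm.and ψ χ) ↔ v ψ ∧ v χ) → v φ

/-- Normal bimodal logic. -/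
structure IsLogic (L : Set BForm) : Prop where
  taut : ∀ φ, IsTaut φ → φ ∈ L
  K0 : BForm.imp (BForm.box0 (BForm.imp (BForm.var 0) (BForm.var 1)))
        (BForm.imp (BForm.box0 (BForm.var 0)) (BForm.box0 (BForm.var 1))) ∈ L
  K1 : BForm.imp (BForm.box1 (BForm.imp (BForm.var 0) (BForm.var 1)))
        (BForm.imp (BForm.box1 (BForm.var 0)) (BForm.box1 (BForm.var 1))) ∈ L
  mp : ∀ φ ψ, BForm.imp φ ψ ∈ L → φ ∈ L → ψ ∈ L
  subst : ∀ φ s, φ ∈ L → BForm.subst s φ ∈ L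
  nec0 : ∀ φ, φ ∈ L → BForm.box0 φ ∈ L
  nec1 : ∀ φ, φ ∈ L → BForm.box1 φ ∈ L

/-- Validity of a (◇₀-)formula in a unimodal frame `⟨W,R⟩`. -/
def UValid0 {W : Type} (R : W → W → Prop) (φ : BForm) : Prop :=
  ∀ (val : ℕ → W → Prop) (w : W), BSat R (fun _ _ => False) val w φ

/-- Validity of a (◇₁-)formula in a unimodal frame `⟨W,S⟩`. -/
def UValid1 {W : Type} (S : W → W → Prop) (φ : BForm) : Prop :=
  ∀ (val : ℕ → W → Prop) (w : W), BSat (fun _ _ => False) S val w φ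

/-- `K4.3`: the unimodal logic (in `◇₀`) of all linear orders. -/
def K43 : Set BForm :=
  {φ | φ.OnlyDia0 ∧ ∀ (T : Type) (R : T → T → Prop), Nonempty T → IsLin R → UValid0 R φ}

/-- `Diff`: the unimodal logic (in `◇₁`) of all difference frames. -/
def DiffLogic : Set BForm :=
  {φ | φ.OnlyDia1 ∧ ∀ (D : Type), Nonempty D → UValid1 (fun a b : D => a ≠ b) φ}

/-- `Log⟨ω,<⟩`: the unimodal logic (in `◇₀`) of the frame `⟨ω,<⟩`. -/
def LogOmega : Set BForm :=
  {φ | φ.OnlyDia0 ∧ UValid0 (fun m n : ℕ => m < n) φ}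

/-- `GL.3`: the unimodal logic (in `◇₀`) of all Noetherian irreflexive linear orders. -/
def GL3 : Set BForm :=
  {φ | φ.OnlyDia0 ∧
    ∀ (T : Type) (R : T → T → Prop), Nonempty T → IsLin R → Noetherian R → UValid0 R φ}

/-- `DisK4.3`: the unimodal logic (in `◇₀`) of all modally discrete weak orders. -/
def DisK43 : Set BForm :=
  {φ | φ.OnlyDia0 ∧
    ∀ (T : Type) (R : T → T → Prop), Nonempty T → WeakOrd R → ModallyDiscrete R → UValid0 R φ}

def commAx1 : BForm :=
  BForm.imp (BForm.box1 (BForm.box0 (BForm.var 0))) (BForm.box0 (BForm.box1 (BForm.var 0)))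
def commAx2 : BForm :=
  BForm.imp (BForm.box0 (BForm.box1 (BForm.var 0))) (BForm.box1 (BForm.box0 (BForm.var 0)))
def commAx3 : BForm :=
  BForm.imp (BForm.dia0 (BForm.box1 (BForm.var 0))) (BForm.box1 (BForm.dia0 (BForm.var 0)))

/-- The commutator `[L0,L1]`: the smallest bimodal logic containing `L0`, `L1` (and
hence their fusion) together with the commutativity/confluence axioms. -/
def Commutator (L0 L1 : Set BForm) : Set BForm :=
  ⋂₀ {L : Set BForm | IsLogic L ∧ L0 ⊆ L ∧ L1 ⊆ L ∧
      commAx1 ∈ L ∧ commAx2 ∈ L ∧ commAx3 ∈ L}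

/-- The product logic `L0 × L1`: the logic of all products of a frame for `L0`
with a frame for `L1`. -/
def ProdLogic (L0 L1 : Set BForm) : Set BForm :=
  {φ | ∀ (A B : Type), Nonempty A → Nonempty B → ∀ (R : A → A → Prop) (S : B → B → Prop),
      (∀ ψ ∈ L0, UValid0 R ψ) → (∀ ψ ∈ L1, UValid1 S ψ) → ProdValid R S φ}

/-- The logic of a class of 2-frames. -/
def LogOf (C : Frame2 → Prop) : Set BForm := {φ | ∀ F, C F → F.Valid φ}

/-- Kripke completeness of a bimodal logic. -/
def KripkeComplete (L : Set BForm) : Prop := ∃ C : Frame2 → Prop, L = LogOf C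

/-- `L`-satisfiability: `φ` is satisfied in some model `M` with `M ⊨ L`. -/
def LSat (L : Set BForm) (φ : BForm) : Prop :=
  ∃ (W : Type) (_ : Nonempty W) (R0 R1 : W → W → Prop) (val : ℕ → W → Prop),
    (∀ ψ ∈ L, ∀ w, BSat R0 R1 val w ψ) ∧ ∃ w, BSat R0 R1 val w φ

/-! ## One-variable first-order temporal logic with counting (FOLTL≠) -/

/-- FOLTL≠-formulas: `φ ::= P(x) | ¬φ | φ∧ψ | ◇_F φ | ∃≠x φ`. -/
inductive TForm : Type
  | atom : ℕ → TForm
  | neg : TForm → TForm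
  | and : TForm → TForm → TForm
  | diaF : TForm → TForm
  | exNe : TForm → TForm

/-- Truth of an FOLTL≠-formula in a first-order temporal model based on the
timeline `⟨T,lt⟩` with domains `D` and interpretation `I`. -/
def TSat {T U : Type} (lt : T → T → Prop) (D : T → Set U) (I : ℕ → T → U → Prop) :
    T → U → TForm → Prop
  | t, a, .atom n => I n t a
  | t, a, .neg φ => ¬ TSat lt D I t a φ
  | t, a, .and φ ψ => TSat lt D I t a φ ∧ TSat lt D I t a ψ
  | t, a, .diaF φ => ∃ t', lt t t' ∧ a ∈ D t' ∧ TSat lt D I t' a φ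
  | t, a, .exNe φ => ∃ b, b ∈ D t ∧ b ≠ a ∧ TSat lt D I t b φ

/-- The standard translation `⋆` from FOLTL≠-formulas to bimodal formulas. -/
def TForm.star : TForm → BForm
  | .atom n => .var n
  | .neg φ => .neg (TForm.star φ)
  | .and φ ψ => .and (TForm.star φ) (TForm.star ψ)
  | .diaF φ => .dia0 (TForm.star φ)
  | .exNe φ => .dia1 (TForm.star φ)

/-- Satisfiability in constant domain models over the timeline `⟨T,lt⟩`. -/
def FOLTLConstSat {T : Type} (lt : T → T → Prop) (φ : TForm) : Prop :=
  ∃ (U : Type) (I : ℕ → T → U → Prop) (t : T) (a : U),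
    TSat lt (fun _ => (Set.univ : Set U)) I t a φ

/-- Satisfiability in decreasing domain models over the timeline `⟨T,lt⟩`. -/
def FOLTLDecSat {T : Type} (lt : T → T → Prop) (φ : TForm) : Prop :=
  ∃ (U : Type) (D : T → Set U), (∀ t, (D t).Nonempty) ∧
    (∀ t t', lt t t' → D t' ⊆ D t) ∧
    ∃ (I : ℕ → T → U → Prop) (t : T) (a : U), a ∈ D t ∧ TSat lt D I t a φ

/-- Satisfiability in expanding domain models over the timeline `⟨T,lt⟩`. -/
def FOLTLExpSat {T : Type} (lt : T → T → Prop) (φ : TForm) : Prop :=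
  ∃ (U : Type) (D : T → Set U), (∀ t, (D t).Nonempty) ∧
    (∀ t t', lt t t' → D t ⊆ D t') ∧
    ∃ (I : ℕ → T → U → Prop) (t : T) (a : U), a ∈ D t ∧ TSat lt D I t a φ

/-- Satisfiability in constant domain models over a class `C` of timelines. -/
def FOLTLConstSatC (C : Frame → Prop) (φ : TForm) : Prop :=
  ∃ F, C F ∧ FOLTLConstSat F.R φ

/-- Satisfiability in decreasing domain models over a class `C` of timelines. -/
def FOLTLDecSatC (C : Frame → Prop) (φ : TForm) : Prop :=
  ∃ F, C F ∧ FOLTLDecSat F.R φ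

/-- Satisfiability in expanding domain models over a class `C` of timelines. -/
def FOLTLExpSatC (C : Frame → Prop) (φ : TForm) : Prop :=
  ∃ F, C F ∧ FOLTLExpSat F.R φ

/-- The class of all linear orders. -/
def AllLin : Frame → Prop := fun F => IsLin F.R

/-- The class of all finite linear orders. -/
def AllFinLin : Frame → Prop := IsFinLinFrame

/-! ## Gödel numbering -/

/-- A fixed effective Gödel numbering of bimodal formulas. -/
def encodeB : BForm → ℕ
  | .var n => Nat.pair 0 n
  | .neg φ => Nat.pair 1 (encodeB φ)
  | .and φ ψ => Nat.pair 2 (Nat.pair (encodeB φ) (encodeB ψ))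
  | .dia0 φ => Nat.pair 3 (encodeB φ)
  | .dia1 φ => Nat.pair 4 (encodeB φ)

/-- A fixed effective Gödel numbering of FOLTL≠-formulas. -/
def encodeT : TForm → ℕ
  | .atom n => Nat.pair 0 n
  | .neg φ => Nat.pair 1 (encodeT φ)
  | .and φ ψ => Nat.pair 2 (Nat.pair (encodeT φ) (encodeT ψ))
  | .diaF φ => Nat.pair 3 (encodeT φ)
  | .exNe φ => Nat.pair 4 (encodeT φ)

/-- The set of codes of bimodal formulas with property `P`. -/
def BCodes (P : BForm → Prop) : ℕ → Prop := fun n => ∃ φ, encodeB φ = n ∧ P φ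

/-- The set of codes of FOLTL≠-formulas with property `P`. -/
def TCodes (P : TForm → Prop) : ℕ → Prop := fun n => ∃ φ, encodeT φ = n ∧ P φ

/-! ## The analytical hierarchy: Σ₁¹ -/

/-- `A ⊆ ℕ` is `Σ₁¹`: in normal form `n ∈ A ↔ ∃ f : ℕ → ℕ, ∀ m, R (n, f̄(m))`
for a computable predicate `R` of the number `n` and finite initial segments of `f`. -/
def Sigma11 (A : ℕ → Prop) : Prop :=
  ∃ R : ℕ × List ℕ → Prop, ComputablePred R ∧
    ∀ n, A n ↔ ∃ f : ℕ → ℕ, ∀ m, R (n, (List.range m).map f)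

/-- `Σ₁¹`-hardness with respect to computable many-one reducibility. -/
def Sigma11Hard (A : ℕ → Prop) : Prop := ∀ B : ℕ → Prop, Sigma11 B → ManyOneReducible B A

/-- `Σ₁¹`-completeness. -/
def Sigma11Complete (A : ℕ → Prop) : Prop := Sigma11 A ∧ Sigma11Hard A

/-! ## Counter (Minsky) machines -/

/-- Counter machine operations: `inl i` increments counter `i`, `inr (inl i)`
decrements counter `i`, `inr (inr i)` zero-tests counter `i`. -/
abbrev CMOp : Type := ℕ ⊕ ℕ ⊕ ℕ

def CMOp.counter : CMOp → ℕ
  | Sum.inl i => i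
  | Sum.inr (Sum.inl i) => i
  | Sum.inr (Sum.inr i) => i

/-- Description of a counter machine: number `N` of counters, number of states
(states are `0,…,states-1`), list of terminal states, and list of instructions
`(q, op, q')`. -/
abbrev CMDesc : Type := ℕ × ℕ × List ℕ × List (ℕ × CMOp × ℕ)

/-- Well-formedness of a counter machine description: `N > 1`, terminal states are
states, instructions are attached to non-terminal states and mention genuine
counters, and every non-terminal state has at least one instruction. -/
def CMWF (M : CMDesc) : Prop :=
  1 < M.1 ∧ (∀ q ∈ M.2.2.1, q < M.2.1) ∧
  (∀ t ∈ M.2.2.2, t.1 < M.2.1 ∧ t.1 ∉ M.2.2.1 ∧ t.2.2 < M.2.1 ∧ CMOp.counter t.2.1 < M.1) ∧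
  (∀ q, q < M.2.1 → q ∉ M.2.2.1 → ∃ t ∈ M.2.2.2, t.1 = q)

/-- A configuration: current state and contents of the counters. -/
abbrev CMConfig : Type := ℕ × (ℕ → ℕ)

/-- Reliable step of a counter machine. -/
def CMStep (M : CMDesc) (σ σ' : CMConfig) : Prop :=
  ∃ op q', (σ.1, op, q') ∈ M.2.2.2 ∧ σ'.1 = q' ∧
    match op with
    | Sum.inl i => σ'.2 i = σ.2 i + 1 ∧ ∀ j, j ≠ i → σ'.2 j = σ.2 j
    | Sum.inr (Sum.inl i) => 0 < σ.2 i ∧ σ'.2 i + 1 = σ.2 i ∧ ∀ j, j ≠ i → σ'.2 j = σ.2 j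
    | Sum.inr (Sum.inr i) => σ.2 i = 0 ∧ ∀ j, σ'.2 j = σ.2 j

/-- Lossy step of a counter machine. -/
def CMStepLossy (M : CMDesc) (σ σ' : CMConfig) : Prop :=
  ∃ c1 c2 : ℕ → ℕ, CMStep M (σ.1, c1) (σ'.1, c2) ∧ (∀ i, c1 i ≤ σ.2 i) ∧ (∀ i, σ'.2 i ≤ c2 i)

/-- The configuration `⟨q, 𝟎⟩` with all-0 counters. -/
def zeroConfig (q : ℕ) : CMConfig := (q, fun _ => 0)

/-- CM non-termination: the machine has an infinite run starting with `⟨q₀,𝟎⟩`. -/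
def CMNonTerm : CMDesc × ℕ → Prop := fun p =>
  CMWF p.1 ∧ ∃ ρ : ℕ → CMConfig, ρ 0 = zeroConfig p.2 ∧ ∀ n, CMStep p.1 (ρ n) (ρ (n+1))

/-- CM reachability: the machine has a run starting with `⟨q₀,𝟎⟩` reaching `q_r`. -/
def CMReach : CMDesc × ℕ × ℕ → Prop := fun p =>
  CMWF p.1 ∧ ∃ (B : ℕ) (ρ : ℕ → CMConfig), ρ 0 = zeroConfig p.2.1 ∧
    (∀ n, n < B → CMStep p.1 (ρ n) (ρ (n+1))) ∧ (ρ B).1 = p.2.2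

/-- CM recurrence: the machine has an infinite run starting with `⟨q₀,𝟎⟩`
visiting `q_r` infinitely often. -/
def CMRecur : CMDesc × ℕ × ℕ → Prop := fun p =>
  CMWF p.1 ∧ ∃ ρ : ℕ → CMConfig, ρ 0 = zeroConfig p.2.1 ∧
    (∀ n, CMStep p.1 (ρ n) (ρ (n+1))) ∧ ∀ n, ∃ m, n ≤ m ∧ (ρ m).1 = p.2.2

/-- LCM reachability: the machine has a lossy run starting with `⟨q₀,𝟎⟩`
reaching `q_r`. -/
def LCMReach : CMDesc × ℕ × ℕ → Prop := fun p =>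
  CMWF p.1 ∧ ∃ (B : ℕ) (ρ : ℕ → CMConfig), ρ 0 = zeroConfig p.2.1 ∧
    (∀ n, n < B → CMStepLossy p.1 (ρ n) (ρ (n+1))) ∧ (ρ B).1 = p.2.2

/-- LCM ω-reachability: for every `k`, the machine has a lossy run starting with
`⟨q₀,𝟎⟩` visiting `q_r` at least `k` times. -/
def LCMOmegaReach : CMDesc × ℕ × ℕ → Prop := fun p =>
  CMWF p.1 ∧ ∀ k : ℕ, ∃ (B : ℕ) (ρ : ℕ → CMConfig), ρ 0 = zeroConfig p.2.1 ∧
    (∀ n, n < B → CMStepLossy p.1 (ρ n) (ρ (n+1))) ∧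
    k ≤ ((Finset.range (B+1)).filter (fun n => (ρ n).1 = p.2.2)).card

/-! ## Particular formulas used in the statements -/

/-- `□₁⁺□₀⁺(◇₀⊤ → □₁◇₀⊤) ∧ φ` (Prop. 2.4 of the paper). -/
def diffDecForm (φ : BForm) : BForm :=
  BForm.and
    (BForm.boxP1 (BForm.boxP0
      (BForm.imp (BForm.dia0 BForm.top) (BForm.box1 (BForm.dia0 BForm.top))))) φ

/-- `D ∧ □₀^{≤n}□₁^{≤n}(◇₀D → D) ∧ φ^D`. -/
def decRelForm (d n : ℕ) (φ : BForm) : BForm :=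
  BForm.and (BForm.var d)
    (BForm.and
      (BForm.boxLe0 n (BForm.boxLe1 n
        (BForm.imp (BForm.dia0 (BForm.var d)) (BForm.var d))))
      (BForm.relativize d φ))

/-- `D ∧ □₀^{≤n}□₁^{≤n}(D → □₀D) ∧ φ^D`. -/
def expRelForm (d n : ℕ) (φ : BForm) : BForm :=
  BForm.and (BForm.var d)
    (BForm.and
      (BForm.boxLe0 n (BForm.boxLe1 n
        (BForm.imp (BForm.var d) (BForm.box0 (BForm.var d)))))
      (BForm.relativize d φ))

/-! ## Machines: guarded register programs -/

inductive Op : Type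
  | inc : ℕ → Op
  | dec : ℕ → Op
  | zero : ℕ → Op
  | nop : Op

abbrev Instr : Type := ℕ × Op × ℕ
abbrev Regs : Type := ℕ → ℕ

def opRel : Op → Regs → Regs → Prop
  | .inc i, σ, τ => τ = Function.update σ i (σ i + 1)
  | .dec i, σ, τ => 0 < σ i ∧ τ = Function.update σ i (σ i - 1)
  | .zero i, σ, τ => σ i = 0 ∧ τ = σ
  | .nop, σ, τ => τ = σ

inductive Prog : Type
  | skip : Prog
  | inc : ℕ → Prog
  | guess : ℕ → Prog
  | seq : Prog → Prog → Prog
  | loop : ℕ → Prog → Prog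

inductive LoopRel (i : ℕ) (E : Regs → Regs → Prop) : Regs → Regs → Prop
  | done (σ : Regs) : σ i = 0 → LoopRel i E σ σ
  | step (σ τ υ : Regs) : 0 < σ i → E (Function.update σ i (σ i - 1)) τ →
      LoopRel i E τ υ → LoopRel i E σ υ

def Exec : Prog → Regs → Regs → Prop
  | .skip, σ, τ => τ = σ
  | .inc i, σ, τ => τ = Function.update σ i (σ i + 1)
  | .guess i, σ, τ => ∃ k, τ = Function.update σ i (σ i + k)
  | .seq P Q, σ, τ => ∃ υ, Exec P σ υ ∧ Exec Q υ τ
  | .loop i P, σ, τ => LoopRel i (Exec P) σ τ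

def Prog.size : Prog → ℕ
  | .skip => 0
  | .inc _ => 1
  | .guess _ => 1
  | .seq P Q => P.size + Q.size
  | .loop _ P => P.size + 2

def compileP : Prog → ℕ → List Instr
  | .skip, _ => []
  | .inc i, s => [(s, .inc i, s + 1)]
  | .guess i, s => [(s, .inc i, s), (s, .nop, s + 1)]
  | .seq P Q, s => compileP P s ++ compileP Q (s + P.size)
  | .loop i P, s => (s, .zero i, s + P.size + 2) :: (s, .dec i, s + 1) ::
      (compileP P (s + 1) ++ [(s + 1 + P.size, .nop, s)])

abbrev Conf : Type := ℕ × Regs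

def Step (M : List Instr) (c d : Conf) : Prop :=
  ∃ op, (c.1, op, d.1) ∈ M ∧ opRel op c.2 d.2

theorem compileP_src (P : Prog) : ∀ s, ∀ ins ∈ compileP P s, s ≤ ins.1 ∧ ins.1 < s + P.size := by
  induction P with
  | skip => intro s ins h; simp [compileP] at h
  | inc i => intro s ins h; simp [compileP] at h; subst h; simp [Prog.size]
  | guess i => intro s ins h; simp [compileP] at h; rcases h with rfl | rfl <;> simp [Prog.size]
  | seq P Q ihP ihQ =>
    intro s ins h
    simp only [compileP, List.mem_append] at h
    rcases h with h | h
    · have := ihP _ _ h; simp only [Prog.size]; omega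
    · have := ihQ _ _ h; simp only [Prog.size]; omega
  | loop i P ih =>
    intro s ins h
    simp only [compileP, List.mem_cons, List.mem_append, List.not_mem_nil, or_false] at h
    rcases h with rfl | rfl | h | rfl
    · simp [Prog.size]
    · simp [Prog.size]
    · have := ih _ _ h; simp only [Prog.size]; omega
    · simp only [Prog.size]; omega

theorem compileP_tgt (P : Prog) : ∀ s, ∀ ins ∈ compileP P s, s ≤ ins.2.2 := by
  induction P with
  | skip => intro s ins h; simp [compileP] at h
  | inc i => intro s ins h; simp [compileP] at h; subst h; simp
  | guess i => intro s ins h; simp [compileP] at h; rcases h with rfl | rfl <;> simp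
  | seq P Q ihP ihQ =>
    intro s ins h
    simp only [compileP, List.mem_append] at h
    rcases h with h | h
    · exact ihP _ _ h
    · have := ihQ _ _ h; omega
  | loop i P ih =>
    intro s ins h
    simp only [compileP, List.mem_cons, List.mem_append, List.not_mem_nil, or_false] at h
    rcases h with rfl | rfl | h | rfl
    · simp; omega
    · simp
    · have := ih _ _ h; omega
    · simp

/-- Instructions of `M` inside the code range of `P` come from `P`. -/
def Covers (M : List Instr) (P : Prog) (s : ℕ) : Prop :=
  ∀ ins ∈ M, s ≤ ins.1 → ins.1 < s + P.size → ins ∈ compileP P s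

theorem run_exec (M : List Instr) (ρ : ℕ → Conf) (hρ : ∀ k, Step M (ρ k) (ρ (k + 1))) (P : Prog) :
    ∀ s, Covers M P s → ∀ k m, k ≤ m → (ρ k).1 = s →
      ¬ (s ≤ (ρ m).1 ∧ (ρ m).1 < s + P.size) →
      ∃ m', k ≤ m' ∧ m' ≤ m ∧ (ρ m').1 = s + P.size ∧ Exec P (ρ k).2 (ρ m').2 := by
  induction P with
  | skip =>
    intro s _ k m hkm hs _
    exact ⟨k, le_rfl, hkm, by simpa [Prog.size] using hs, rfl⟩
  | inc i =>
    intro s hc k m hkm hs hout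
    simp only [Prog.size] at hout ⊢
    have hne : k ≠ m := by rintro rfl; omega
    obtain ⟨op, hop, hrel⟩ := hρ k
    have hh := hc _ hop (by simp [hs]) (by simp [hs, Prog.size])
    simp only [compileP, List.mem_cons, List.not_mem_nil, or_false, Prod.mk.injEq] at hh
    obtain ⟨_, rfl, h3⟩ := hh
    exact ⟨k + 1, by omega, by omega, h3, hrel⟩
  | guess i =>
    intro s hc k m hkm hs hout
    simp only [Prog.size] at hout ⊢
    obtain ⟨d, hd⟩ : ∃ d, d = m - k := ⟨_, rfl⟩
    induction d generalizing k with
    | zero =>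
      have : k = m := by omega
      subst this; omega
    | succ d ih =>
      obtain ⟨op, hop, hrel⟩ := hρ k
      have hh := hc _ hop (by simp [hs]) (by simp [hs, Prog.size])
      simp only [compileP, List.mem_cons, List.not_mem_nil, or_false, Prod.mk.injEq] at hh
      rcases hh with ⟨_, rfl, h3⟩ | ⟨_, rfl, h3⟩
      · obtain ⟨m', h1, h2, h4, j, hj⟩ := ih (k + 1) (by omega) h3 (by omega)
        refine ⟨m', by omega, h2, h4, j + 1, ?_⟩
        rw [hj]
        simp only [opRel] at hrel
        rw [hrel]
        simp [Nat.add_assoc, Nat.add_comm 1 j]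
      · refine ⟨k + 1, by omega, by omega, h3, 0, ?_⟩
        simpa [opRel] using hrel
  | seq P Q ihP ihQ =>
    intro s hc k m hkm hs hout
    simp only [Prog.size] at hout ⊢
    have hcP : Covers M P s := by
      intro ins hi h1 h2
      have := hc ins hi h1 (by simp only [Prog.size]; omega)
      simp only [compileP, List.mem_append] at this
      rcases this with h | h
      · exact h
      · have := (compileP_src _ _ _ h).1; omega
    have hcQ : Covers M Q (s + P.size) := by
      intro ins hi h1 h2
      have := hc ins hi (by omega) (by simp only [Prog.size]; omega)
      simp only [compileP, List.mem_append] at this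
      rcases this with h | h
      · have := (compileP_src _ _ _ h).2; omega
      · exact h
    obtain ⟨m1, a1, a2, a3, a4⟩ := ihP s hcP k m hkm hs (by omega)
    obtain ⟨m2, b1, b2, b3, b4⟩ := ihQ _ hcQ m1 m a2 a3 (by omega)
    exact ⟨m2, by omega, b2, by omega, _, a4, b4⟩
  | loop i P ih =>
    intro s hc k m hkm hs hout
    simp only [Prog.size] at hout ⊢
    have hcP : Covers M P (s + 1) := by
      intro ins hi h1 h2
      have := hc ins hi (by omega) (by simp only [Prog.size]; omega)
      simp only [compileP, List.mem_cons, List.mem_append, List.not_mem_nil, or_false] at this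
      rcases this with rfl | rfl | h | rfl
      · simp at h1
      · simp at h1
      · exact h
      · simp at h2
    obtain ⟨d, hd⟩ : ∃ d, d = m - k := ⟨_, rfl⟩
    induction d using Nat.strong_induction_on generalizing k with
    | _ d ihd =>
      have hne : k ≠ m := by rintro rfl; omega
      obtain ⟨op, hop, hrel⟩ := hρ k
      have hh := hc _ hop (by simp [hs]) (by simp [hs, Prog.size])
      simp only [compileP, List.mem_cons, List.mem_append, List.not_mem_nil, or_false,
        Prod.mk.injEq] at hh
      rcases hh with ⟨_, rfl, h3⟩ | ⟨_, rfl, h3⟩ | h | ⟨h, _⟩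
      · refine ⟨k + 1, by omega, by omega, by omega, ?_⟩
        obtain ⟨e1, e2⟩ := hrel
        rw [e2]
        exact LoopRel.done _ e1
      · obtain ⟨e1, e2⟩ := hrel
        obtain ⟨m1, a1, a2, a3, a4⟩ := ih (s + 1) hcP (k + 1) m (by omega) h3 (by omega)
        have hne1 : m1 ≠ m := by rintro rfl; omega
        obtain ⟨op', hop', hrel'⟩ := hρ m1
        have hh := hc _ hop' (by omega) (by simp only [Prog.size]; omega)
        simp only [compileP, List.mem_cons, List.mem_append, List.not_mem_nil, or_false,
          Prod.mk.injEq] at hh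
        rcases hh with ⟨h, _⟩ | ⟨h, _⟩ | h | ⟨_, rfl, h3'⟩
        · omega
        · omega
        · have := (compileP_src _ _ _ h).2
          simp only at this; omega
        · obtain ⟨m2, b1, b2, b3, b4⟩ := ihd (m - (m1 + 1)) (by omega) (m1 + 1) (by omega) h3' rfl
          refine ⟨m2, by omega, b2, b3, ?_⟩
          simp only [opRel] at hrel'
          rw [hrel'] at b4
          rw [e2] at a4
          exact LoopRel.step _ _ _ e1 a4 b4
      · have := (compileP_src _ _ _ h).1
        simp only at this; omega
      · omega

theorem exec_path (M : List Instr) (P : Prog) : ∀ s, (∀ ins ∈ compileP P s, ins ∈ M) → ∀ σ τ,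
    Exec P σ τ → Relation.ReflTransGen (Step M) (s, σ) (s + P.size, τ) := by
  induction P with
  | skip => intro s _ σ τ h; cases h; exact Relation.ReflTransGen.refl
  | inc i =>
    intro s hM σ τ h
    exact Relation.ReflTransGen.single ⟨.inc i, hM _ (by simp [compileP, Prog.size]), h⟩
  | guess i =>
    rintro s hM σ τ ⟨k, rfl⟩
    have h1 : Relation.ReflTransGen (Step M) (s, σ) (s, Function.update σ i (σ i + k)) := by
      induction k with
      | zero => simp; exact Relation.ReflTransGen.refl
      | succ k ih =>
        refine ih.tail ⟨.inc i, hM _ (by simp [compileP]), ?_⟩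
        simp [opRel, Nat.add_assoc]
    exact h1.tail ⟨.nop, hM _ (by simp [compileP, Prog.size]), rfl⟩
  | seq P Q ihP ihQ =>
    rintro s hM σ τ ⟨υ, h1, h2⟩
    have a := ihP s (fun ins hi => hM ins (by simp [compileP, hi])) _ _ h1
    have b := ihQ (s + P.size) (fun ins hi => hM ins (by simp [compileP, hi])) _ _ h2
    simp only [Prog.size, ← Nat.add_assoc]
    exact a.trans b
  | loop i P ih =>
    intro s hM σ τ h
    simp only [Exec] at h
    induction h with
    | done σ h0 =>
      exact Relation.ReflTransGen.single ⟨.zero i, hM _ (by simp [compileP, Prog.size, Nat.add_assoc]), h0, rfl⟩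
    | step σ τ υ h0 h1 _ ihl =>
      refine Relation.ReflTransGen.head (b := (s + 1, Function.update σ i (σ i - 1)))
        ⟨.dec i, hM _ (by simp [compileP]), h0, rfl⟩ ?_
      refine (ih (s + 1) (fun ins hi => hM ins (by simp [compileP, hi])) _ _ h1).trans ?_
      refine Relation.ReflTransGen.head (b := (s, τ)) ⟨.nop, hM _ (by simp [compileP]), rfl⟩ ihl

def GoodRun (M : List Instr) (e n : ℕ) : Prop :=
  ∃ (lab : ℕ → Instr) (reg : ℕ → Regs), (∀ t, lab t ∈ M) ∧ (lab 0).1 = 0 ∧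
    (∀ t, (lab (t + 1)).1 = (lab t).2.2) ∧ (reg 0 = fun _ => 0) ∧
    (∀ t, opRel (lab t).2.1 (reg t) (reg (t + 1))) ∧
    (∀ t, ∃ t', t < t' ∧ (lab t').1 = e) ∧
    (∀ t, lab t = (0, Op.nop, 1) → t = n)

def mainM (P : Prog) : List Instr :=
  (0, Op.inc 0, 0) :: (0, Op.nop, 1) :: (compileP P 1 ++ [(1 + P.size, Op.nop, 1)])

def init (n : ℕ) : Regs := Function.update (fun _ => 0) 0 n

theorem mainM_cases {P : Prog} {ins : Instr} (h : ins ∈ mainM P) :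
    ins = (0, Op.inc 0, 0) ∨ ins = (0, Op.nop, 1) ∨ ins ∈ compileP P 1 ∨
      ins = (1 + P.size, Op.nop, 1) := by
  simpa [mainM] using h

theorem mainM_ge {P : Prog} {ins : Instr} (h : ins ∈ mainM P) (h1 : 1 ≤ ins.1) : 1 ≤ ins.2.2 := by
  rcases mainM_cases h with rfl | rfl | h | rfl
  · simp at h1
  · simp at h1
  · exact compileP_tgt _ _ _ h
  · simp

theorem goodRun_chain (P : Prog) (n : ℕ) (h : GoodRun (mainM P) (1 + P.size) n) :
    ∃ σ : ℕ → Regs, σ 0 = init n ∧ ∀ k, Exec P (σ k) (σ (k + 1)) := by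
  obtain ⟨lab, reg, hM, h0, hnext, hr0, hop, hrec, hex⟩ := h
  -- the exit happens
  have hzero : ∀ t, (∀ s < t, lab s ≠ (0, Op.nop, 1)) →
      (lab t).1 = 0 ∧ reg t = init t := by
    intro t
    induction t with
    | zero => intro _; refine ⟨h0, ?_⟩; rw [hr0]; ext j; simp [init]
    | succ t ih =>
      intro hs
      obtain ⟨a, b⟩ := ih (fun s hs' => hs s (by omega))
      have hl : lab t = (0, Op.inc 0, 0) := by
        rcases mainM_cases (hM t) with h | h | h | h
        · exact h
        · exact absurd h (hs t (by omega))
        · have := (compileP_src _ _ _ h).1; omega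
        · rw [h] at a; simp at a
      refine ⟨by rw [hnext, hl], ?_⟩
      have := hop t
      rw [hl, b] at this
      rw [this]; simp [init]
  have hexit : ∃ t, lab t = (0, Op.nop, 1) := by
    by_contra hne
    push Not at hne
    obtain ⟨t, _, ht⟩ := hrec 0
    have := (hzero t (fun s _ => hne s)).1
    omega
  obtain ⟨t, ht⟩ := hexit
  have htn := hex t ht
  subst htn
  have hreg := (hzero t (fun s hs hh => by have := hex s hh; omega)).2
  have hst : (lab (t + 1)).1 = 1 := by rw [hnext, ht]
  have hrg : reg (t + 1) = init t := by
    have := hop t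
    rw [ht] at this
    simp only [opRel] at this
    rw [this, hreg]
  have hcov : Covers (mainM P) P 1 := by
    intro ins hi h1 h2
    rcases mainM_cases hi with rfl | rfl | h | rfl
    · simp at h1
    · simp at h1
    · exact h
    · simp at h2
  have hstep : ∀ k, (lab k).1 = 1 → ∃ m, (lab m).1 = 1 ∧ Exec P (reg k) (reg m) := by
    intro k hk
    obtain ⟨m, hm, he⟩ := hrec k
    obtain ⟨m', a1, a2, a3, a4⟩ := run_exec (mainM P) (fun k => ((lab k).1, reg k))
      (fun k => ⟨(lab k).2.1, by
        have : ((lab k).1, (lab k).2.1, (lab (k+1)).1) = lab k := by rw [hnext]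
        simp only [this]; exact hM k, hop k⟩) P 1 hcov k m hm.le hk (by simp only; omega)
    refine ⟨m' + 1, ?_, ?_⟩
    · rcases mainM_cases (hM m') with h | h | h | h
      · rw [h] at a3; simp at a3; omega
      · rw [h] at a3; simp at a3; omega
      · have := (compileP_src _ _ _ h).2; simp only at a3; omega
      · rw [hnext, h]
    · rcases mainM_cases (hM m') with h | h | h | h
      · rw [h] at a3; simp at a3; omega
      · rw [h] at a3; simp at a3; omega
      · have := (compileP_src _ _ _ h).2; simp only at a3; omega
      · have := hop m'
        rw [h] at this
        simp only [opRel] at this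
        rw [this]; exact a4
  choose! f hf1 hf2 using hstep
  let T : ℕ → ℕ := fun k => f^[k] (t + 1)
  have hT : ∀ k, (lab (T k)).1 = 1 := by
    intro k
    induction k with
    | zero => exact hst
    | succ k ih => simp only [T, Function.iterate_succ_apply']; exact hf1 _ ih
  refine ⟨fun k => reg (T k), hrg, fun k => ?_⟩
  have := hf2 _ (hT k)
  simp only [T, Function.iterate_succ_apply'] at this ⊢
  exact this

/-- Gluing finite paths into an infinite run. -/
theorem glue {X : Type} (S : X → X → Prop) (a : X) (g : ℕ → X) (ha : Relation.ReflTransGen S a (g 0)) (hg : ∀ k, Relation.TransGen S (g k) (g (k + 1))) :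
    ∃ ρ : ℕ → X, ρ 0 = a ∧ (∀ t, S (ρ t) (ρ (t + 1))) ∧ ∀ t, ∃ t', t < t' ∧ ∃ k, ρ t' = g k := by
  classical
  let Pth : ℕ → X → X → Prop := fun l a b => ∃ p : ℕ → X, p 0 = a ∧ p l = b ∧ ∀ i < l, S (p i) (p (i + 1))
  have htail : ∀ l a b, Pth (l + 1) a b → ∃ c, S a c ∧ Pth l c b := by
    rintro l a b ⟨p, h0, h1, h2⟩
    refine ⟨p 1, h0 ▸ h2 0 (by omega), fun i => p (i + 1), rfl, h1, fun i hi => h2 (i + 1) (by omega)⟩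
  have hex : ∀ a b, Relation.ReflTransGen S a b → ∃ l, Pth l a b := by
    intro a b h
    induction h using Relation.ReflTransGen.head_induction_on with
    | refl => exact ⟨0, fun _ => b, rfl, rfl, by simp⟩
    | @head x c hac _ ih =>
      obtain ⟨l, p, h0, h1, h2⟩ := ih
      refine ⟨l + 1, fun i => Nat.casesOn i x p, rfl, h1, ?_⟩
      intro i hi
      cases i with
      | zero => simpa [h0] using hac
      | succ i => exact h2 i (by omega)
  let Y := {q : X × ℕ × ℕ // Pth q.2.2 q.1 (g q.2.1)}
  have hnext : ∀ q : Y, ∃ q' : Y, S q.1.1 q'.1.1 ∧ (q.1.2.2 ≠ 0 → q'.1.2.2 < q.1.2.2) := by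
    rintro ⟨⟨x, k, l⟩, hq⟩
    cases l with
    | zero =>
      obtain ⟨p, h0, h1, _⟩ := hq
      simp only at h0 h1
      obtain ⟨c, hc, hcr⟩ := Relation.TransGen.head'_iff.mp (hg k)
      obtain ⟨l, hl⟩ := hex _ _ hcr
      refine ⟨⟨(c, k + 1, l), hl⟩, ?_, by simp⟩
      simp only [← h0, h1]; exact hc
    | succ l =>
      obtain ⟨c, hc, hp⟩ := htail _ _ _ hq
      exact ⟨⟨(c, k, l), hp⟩, hc, by simp⟩
  choose f hf1 hf2 using hnext
  obtain ⟨l0, hl0⟩ := hex _ _ ha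
  let y0 : Y := ⟨(a, 0, l0), hl0⟩
  let y : ℕ → Y := fun t => f^[t] y0
  have hy : ∀ t, y (t + 1) = f (y t) := fun t => Function.iterate_succ_apply' _ _ _
  have hhit : ∀ l t, (y t).1.2.2 = l → ∃ t', t ≤ t' ∧ ∃ k, (y t').1.1 = g k := by
    intro l
    induction l using Nat.strong_induction_on with
    | _ l ih =>
      intro t ht
      by_cases h0 : l = 0
      · refine ⟨t, le_rfl, (y t).1.2.1, ?_⟩
        obtain ⟨p, h1, h2, _⟩ := (y t).2
        rw [ht, h0] at h2
        rw [← h1, h2]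
      · obtain ⟨t', a, b⟩ := ih _ (by have := hf2 (y t) (by omega); rw [ht] at this; exact this) (t + 1) (by rw [hy])
        exact ⟨t', by omega, b⟩
  refine ⟨fun t => (y t).1.1, rfl, fun t => by simp only [hy]; exact hf1 _, fun t => ?_⟩
  obtain ⟨t', a, b⟩ := hhit _ (t + 1) rfl
  exact ⟨t', by omega, b⟩

theorem chain_goodRun (P : Prog) (n : ℕ) (σ : ℕ → Regs) (h0 : σ 0 = init n)
    (hσ : ∀ k, Exec P (σ k) (σ (k + 1))) : GoodRun (mainM P) (1 + P.size) n := by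
  have hsub : ∀ ins ∈ compileP P 1, ins ∈ mainM P := fun ins h => by simp [mainM, h]
  have hp : ∀ k, Relation.ReflTransGen (Step (mainM P)) (1, σ k) (1 + P.size, σ (k + 1)) :=
    fun k => exec_path _ P 1 hsub _ _ (hσ k)
  have hback : ∀ τ, Step (mainM P) (1 + P.size, τ) (1, τ) := fun τ => ⟨.nop, by simp [mainM], rfl⟩
  obtain ⟨ρ, r0, rs, rr⟩ := glue (Step (mainM P)) (1, σ 0) (fun k => (1 + P.size, σ (k + 1))) (hp 0)
    (fun k => Relation.TransGen.head' (hback _) (hp (k + 1)))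
  have hpos : ∀ t, 1 ≤ (ρ t).1 := by
    intro t
    induction t with
    | zero => rw [r0]
    | succ t ih =>
      obtain ⟨op, hop, _⟩ := rs t
      exact mainM_ge hop ih
  let κ : ℕ → Conf := fun t => if t ≤ n then (0, init t) else ρ (t - (n + 1))
  have hκ : ∀ t, ∃ op, ((κ t).1, op, (κ (t + 1)).1) ∈ mainM P ∧ opRel op (κ t).2 (κ (t + 1)).2 ∧
      (((κ t).1, op, (κ (t + 1)).1) = (0, Op.nop, 1) → t = n) := by
    intro t
    rcases lt_trichotomy t n with h | h | h
    · have e1 : κ t = (0, init t) := if_pos h.le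
      have e2 : κ (t + 1) = (0, init (t + 1)) := if_pos h
      rw [e1, e2]
      exact ⟨.inc 0, by simp [mainM], by simp [opRel, init], by simp⟩
    · subst h
      have e1 : κ t = (0, init t) := if_pos le_rfl
      have e2 : κ (t + 1) = (1, σ 0) := by
        simp only [κ]; rw [if_neg (by omega), ← r0]; simp
      rw [e1, e2, h0]
      exact ⟨.nop, by simp [mainM], rfl, by simp⟩
    · have e1 : κ t = ρ (t - (n + 1)) := if_neg (by omega)
      have e2 : κ (t + 1) = ρ (t - (n + 1) + 1) := by
        simp only [κ]; rw [if_neg (by omega)]; congr 1; omega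
      rw [e1, e2]
      obtain ⟨op, a, b⟩ := rs (t - (n + 1))
      refine ⟨op, a, b, fun hh => ?_⟩
      have := hpos (t - (n + 1))
      rw [(Prod.mk.inj hh).1] at this
      omega
  choose op hop1 hop2 hop3 using hκ
  refine ⟨fun t => ((κ t).1, op t, (κ (t + 1)).1), fun t => (κ t).2, hop1, ?_, fun t => rfl, ?_, hop2, ?_, hop3⟩
  · simp [κ]
  · ext j; simp [κ, init]
  · intro t
    obtain ⟨t', h1, k, hk⟩ := rr t
    refine ⟨t' + (n + 1), by omega, ?_⟩
    have : κ (t' + (n + 1)) = ρ t' := by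
      simp only [κ]; rw [if_neg (by omega)]; congr 1; omega
    simp only [this, hk]

theorem goodRun_iff (P : Prog) (n : ℕ) : GoodRun (mainM P) (1 + P.size) n ↔
    ∃ σ : ℕ → Regs, σ 0 = init n ∧ ∀ k, Exec P (σ k) (σ (k + 1)) :=
  ⟨goodRun_chain P n, fun ⟨σ, h0, h⟩ => chain_goodRun P n σ h0 h⟩

theorem loop_det (i : ℕ) (P : Prog) (N : ℕ) (h : ℕ → Regs) (hi : ∀ k ≤ N, h k i = N - k)
    (hb : ∀ k < N, ∀ τ, Exec P (Function.update (h k) i (N - k - 1)) τ ↔ τ = h (k + 1)) (τ : Regs) :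
    Exec (.loop i P) (h 0) τ ↔ τ = h N := by
  have key : ∀ d k, k + d = N → (LoopRel i (Exec P) (h k) τ ↔ τ = h N) := by
    intro d
    induction d with
    | zero =>
      intro k hk
      have hk : k = N := by omega
      subst hk
      have h0 := hi k le_rfl
      constructor
      · intro hl
        cases hl with
        | done _ _ => rfl
        | step _ τ' _ hp _ _ => omega
      · rintro rfl
        exact LoopRel.done _ (by omega)
    | succ d ih =>
      intro k hk
      have h0 := hi k (by omega)
      constructor
      · intro hl
        cases hl with
        | done _ hz => omega
        | step _ τ' _ hp he hl' =>
          rw [h0, hb k (by omega)] at he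
          subst he
          exact (ih (k + 1) (by omega)).1 hl'
      · intro ht
        refine LoopRel.step _ (h (k + 1)) _ (by omega) ?_ ((ih (k + 1) (by omega)).2 ht)
        rw [h0, hb k (by omega)]
  exact key N 0 (by omega)

def clearP (i : ℕ) : Prog := .loop i .skip
def moveP (i j : ℕ) : Prog := .loop i (.inc j)
def copyP (i j t : ℕ) : Prog := .seq (.loop i (.seq (.inc j) (.inc t))) (moveP t i)

theorem exec_seq (P Q : Prog) (σ τ : Regs) : Exec (.seq P Q) σ τ ↔ ∃ υ, Exec P σ υ ∧ Exec Q υ τ :=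
  Iff.rfl

theorem exec_inc (i : ℕ) (σ τ : Regs) : Exec (.inc i) σ τ ↔ τ = Function.update σ i (σ i + 1) :=
  Iff.rfl

theorem exec_clear (i : ℕ) (σ τ : Regs) : Exec (clearP i) σ τ ↔ τ = Function.update σ i 0 := by
  have := loop_det i .skip (σ i) (fun k => Function.update σ i (σ i - k)) (by simp) (by
    intro k hk τ
    simp only [Exec, Function.update_idem, Nat.sub_add_eq]) τ
  simpa [clearP] using this

theorem exec_move (i j : ℕ) (hij : i ≠ j) (σ τ : Regs) :
    Exec (moveP i j) σ τ ↔ τ = Function.update (Function.update σ i 0) j (σ j + σ i) := by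
  have := loop_det i (.inc j) (σ i)
    (fun k => Function.update (Function.update σ i (σ i - k)) j (σ j + k)) (by simp [hij]) (by
    intro k hk τ
    simp only [exec_inc]
    refine Eq.congr_right ?_
    funext l
    simp only [Function.update_apply]
    split_ifs <;> first | omega | grind) τ
  simpa [moveP] using this

theorem exec_copy (i j t : ℕ) (hij : i ≠ j) (hit : i ≠ t) (hjt : j ≠ t) (σ τ : Regs) (ht : σ t = 0) :
    Exec (copyP i j t) σ τ ↔ τ = Function.update σ j (σ j + σ i) := by
  have h1 := loop_det i (.seq (.inc j) (.inc t)) (σ i)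
    (fun k => Function.update (Function.update (Function.update σ i (σ i - k)) j (σ j + k)) t k)
    (by simp [hij, hit]) (by
    intro k hk τ
    simp only [exec_inc, exec_seq, exists_eq_left]
    refine Eq.congr_right ?_
    funext l
    simp only [Function.update_apply]
    split_ifs <;> first | omega | grind)
  have h0 : (Function.update (Function.update (Function.update σ i (σ i - 0)) j (σ j + 0)) t 0) = σ := by
    funext l
    simp only [Function.update_apply]
    split_ifs <;> first | omega | grind
  simp only [h0] at h1
  simp only [copyP, exec_seq, h1, exists_eq_left, exec_move _ _ hit.symm]
  refine Eq.congr_right ?_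
  funext l
  simp only [Function.update_apply]
  split_ifs <;> first | omega | grind

/-- Compilability of a partial function. -/
def Comp {n : ℕ} (f : List.Vector ℕ n →. ℕ) : Prop :=
  ∀ (inp : Fin n → ℕ) (o b : ℕ), (∀ i, inp i < b) → o < b → (∀ i, inp i ≠ o) →
    ∃ P, ∀ σ : Regs, (∀ j, b ≤ j → σ j = 0) → ∀ τ, Exec P σ τ ↔
      ∃ y ∈ f (List.Vector.ofFn fun i => σ (inp i)), τ = Function.update σ o (σ o + y)

theorem comp_zero : Comp (n := 0) (fun _ => Part.some 0) := by
  intro inp o b _ _ _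
  refine ⟨.skip, fun σ _ τ => ?_⟩
  simp [Exec]

theorem comp_get {n : ℕ} (i : Fin n) : Comp (fun v => Part.some (v.get i)) := by
  intro inp o b h1 h2 h3
  refine ⟨copyP (inp i) o b, fun σ hσ τ => ?_⟩
  rw [exec_copy _ _ _ (h3 i) (h1 i).ne h2.ne _ _ (hσ b le_rfl)]
  simp

theorem comp_succ : Comp (n := 1) (fun v => Part.some (Nat.succ v.head)) := by
  intro inp o b h1 h2 h3
  refine ⟨.seq (copyP (inp 0) o b) (.inc o), fun σ hσ τ => ?_⟩
  simp only [exec_seq, exec_copy _ _ _ (h3 0) (h1 0).ne h2.ne _ _ (hσ b le_rfl), exists_eq_left, exec_inc]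
  simp [Nat.add_assoc]

theorem mem_mOfFn {n : ℕ} (g : Fin n → Part ℕ) (y : List.Vector ℕ n) :
    y ∈ List.Vector.mOfFn g ↔ ∀ i, y.get i ∈ g i := by
  induction n with
  | zero => simp [List.Vector.mOfFn, Part.mem_some_iff, pure, PFun.pure]; 
            exact List.Vector.eq_nil y
  | succ n ih =>
    simp only [List.Vector.mOfFn, Part.bind_eq_bind, Part.mem_bind_iff, Part.pure_eq_some, Part.mem_some_iff, ih]
    constructor
    · rintro ⟨a, ha, v, hv, rfl⟩ i
      refine Fin.cases ?_ (fun i => ?_) i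
      · simpa using ha
      · simpa using hv i
    · intro h
      refine ⟨y.head, by simpa using h 0, y.tail, fun i => by simpa using h i.succ, by simp⟩

def seqList : List Prog → Prog
  | [] => .skip
  | P :: l => .seq P (seqList l)

theorem exec_clears (b n : ℕ) : ∃ P, ∀ σ τ, Exec P σ τ ↔ τ = fun j => if b ≤ j ∧ j < b + n then 0 else σ j := by
  induction n with
  | zero => refine ⟨.skip, fun σ τ => ?_⟩
            simp only [Exec]
            refine Eq.congr_right ?_
            funext j
            rw [if_neg (by omega)]
  | succ n ih =>
    obtain ⟨P, hP⟩ := ih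
    refine ⟨.seq P (clearP (b + n)), fun σ τ => ?_⟩
    simp only [exec_seq, hP, exists_eq_left, exec_clear]
    refine Eq.congr_right ?_
    funext j
    simp only [Function.update_apply]
    split_ifs <;> first | omega | rfl

theorem comp_comp {m n : ℕ} (f : List.Vector ℕ n →. ℕ) (g : Fin n → List.Vector ℕ m →. ℕ)
    (hf : Comp f) (hg : ∀ i, Comp (g i)) : Comp (fun v => (List.Vector.mOfFn fun i => g i v) >>= f) := by
  intro inp o b h1 h2 h3
  have hpre : ∀ k ≤ n, ∃ P, ∀ σ : Regs, (∀ j, b ≤ j → σ j = 0) → ∀ τ, Exec P σ τ ↔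
      ∃ y : ℕ → ℕ, (∀ i (hi : i < n), i < k → y i ∈ g ⟨i, hi⟩ (List.Vector.ofFn fun i => σ (inp i))) ∧
        τ = fun j => if b ≤ j ∧ j < b + k then y (j - b) else σ j := by
    intro k
    induction k with
    | zero =>
      intro _
      refine ⟨.skip, fun σ hσ τ => ?_⟩
      simp only [Exec]
      constructor
      · rintro rfl
        refine ⟨fun _ => 0, by simp, ?_⟩
        funext j; rw [if_neg (by omega)]
      · rintro ⟨y, _, rfl⟩
        funext j; rw [if_neg (by omega)]
    | succ k ih =>
      intro hk
      obtain ⟨P, hP⟩ := ih (by omega)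
      obtain ⟨Q, hQ⟩ := hg ⟨k, by omega⟩ inp (b + k) (b + k + 1) (fun i => by have := h1 i; omega) (by omega)
        (fun i => by have := h1 i; omega)
      refine ⟨.seq P Q, fun σ hσ τ => ?_⟩
      have hin : ∀ (y : ℕ → ℕ), (List.Vector.ofFn fun i => (fun j => if b ≤ j ∧ j < b + k then y (j - b) else σ j) (inp i))
          = (List.Vector.ofFn fun i => σ (inp i)) := by
        intro y
        congr 1; funext i
        have := h1 i
        simp only; rw [if_neg (by omega)]
      have hz : ∀ (y : ℕ → ℕ), ∀ j, b + k + 1 ≤ j → (fun j => if b ≤ j ∧ j < b + k then y (j - b) else σ j) j = 0 := by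
        intro y j hj
        simp only; rw [if_neg (by omega)]; exact hσ j (by omega)
      simp only [exec_seq, hP σ hσ]
      constructor
      · rintro ⟨υ, ⟨y, hy, rfl⟩, he⟩
        rw [hQ _ (hz y), hin y] at he
        obtain ⟨z, hz1, rfl⟩ := he
        refine ⟨Function.update y k z, ?_, ?_⟩
        · intro i hi hik
          by_cases hk' : i = k
          · subst hk'; simpa using hz1
          · rw [Function.update_of_ne hk']; exact hy i hi (by omega)
        · funext j
          have := hσ (b + k) (by omega)
          simp only [Function.update_apply]
          split_ifs <;> first | omega | rfl
      · rintro ⟨y, hy, rfl⟩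
        refine ⟨_, ⟨y, fun i hi hik => hy i hi (by omega), rfl⟩, ?_⟩
        rw [hQ _ (hz y), hin y]
        refine ⟨y k, hy k (by omega) (by omega), ?_⟩
        funext j
        have := hσ (b + k) (by omega)
        simp only [Function.update_apply]
        split_ifs <;> first | omega | rfl | (subst_vars; simp; omega) | skip
  obtain ⟨P, hP⟩ := hpre n le_rfl
  obtain ⟨Q, hQ⟩ := hf (fun i => b + i) o (b + n) (fun i => by omega) (by omega) (fun i => by omega)
  obtain ⟨C, hC⟩ := exec_clears b n
  refine ⟨.seq P (.seq Q C), fun σ hσ τ => ?_⟩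
  have hz : ∀ (y : ℕ → ℕ), ∀ j, b + n ≤ j → (fun j => if b ≤ j ∧ j < b + n then y (j - b) else σ j) j = 0 := by
    intro y j hj
    simp only; rw [if_neg (by omega)]; exact hσ j (by omega)
  have hin : ∀ (y : ℕ → ℕ), (List.Vector.ofFn fun i : Fin n => (fun j => if b ≤ j ∧ j < b + n then y (j - b) else σ j) (b + i))
      = (List.Vector.ofFn fun i : Fin n => y i) := by
    intro y
    congr 1; funext i
    simp only; rw [if_pos (by omega)]; congr 1; omega
  have hfin : ∀ (y : ℕ → ℕ) z, (fun j => if b ≤ j ∧ j < b + n then 0 else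
      (Function.update (fun j => if b ≤ j ∧ j < b + n then y (j - b) else σ j) o
        ((fun j => if b ≤ j ∧ j < b + n then y (j - b) else σ j) o + z)) j) = Function.update σ o (σ o + z) := by
    intro y z
    funext j
    have := hσ j
    simp only [Function.update_apply]
    split_ifs <;> first | omega | rfl
  have hmem : ∀ (v : List.Vector ℕ m) (z : ℕ), z ∈ ((List.Vector.mOfFn fun i => g i v) >>= f) ↔
      ∃ ys : List.Vector ℕ n, (∀ i, ys.get i ∈ g i v) ∧ z ∈ f ys := by
    intro v z
    refine Iff.trans (Part.mem_bind_iff (f := List.Vector.mOfFn fun i => (g i v : Part ℕ)) (g := f)) ?_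
    exact exists_congr fun ys => and_congr (mem_mOfFn (fun i => (g i v : Part ℕ)) ys) Iff.rfl
  simp only [exec_seq, hP σ hσ, hC, hmem]
  constructor
  · rintro ⟨υ, ⟨y, hy, rfl⟩, υ', he, rfl⟩
    rw [hQ _ (hz y), hin y] at he
    obtain ⟨z, hz1, rfl⟩ := he
    refine ⟨z, ⟨_, fun i => ?_, hz1⟩, hfin y z⟩
    rw [List.Vector.get_ofFn]; exact hy i i.2 i.2
  · rintro ⟨z, ⟨ys, hy, hz1⟩, rfl⟩
    obtain ⟨Y, hY⟩ : ∃ Y : ℕ → ℕ, ∀ i (h : i < n), Y i = ys.get ⟨i, h⟩ :=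
      ⟨fun k => if h : k < n then ys.get ⟨k, h⟩ else 0, fun i h => by simp [h]⟩
    have hys : ys = List.Vector.ofFn fun i : Fin n => Y i := by
      ext i; simp [hY]
    refine ⟨_, ⟨Y, ?_, rfl⟩, _, ?_, (hfin Y z).symm⟩
    · intro i hi _
      rw [hY i hi]; exact hy ⟨i, hi⟩
    · rw [hQ _ (hz _), hin, ← hys]
      exact ⟨z, hz1, rfl⟩

theorem comp_prec {n : ℕ} (f : List.Vector ℕ n → ℕ) (g : List.Vector ℕ (n + 2) → ℕ)
    (hf : Comp (fun v => Part.some (f v))) (hg : Comp (fun v => Part.some (g v))) :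
    Comp (fun v : List.Vector ℕ (n + 1) => Part.some
      (v.head.rec (f v.tail) fun y IH => g (y ::ᵥ IH ::ᵥ v.tail) : ℕ)) := by
  intro inp o b h1 h2 h3
  have h10 := h1 0
  obtain ⟨P, hP⟩ := hf (fun i => inp i.succ) (b + 1) (b + 3) (fun i => by have := h1 i.succ; omega)
    (by omega) (fun i => by have := h1 i.succ; omega)
  obtain ⟨Q, hQ⟩ := hg (Fin.cons b (Fin.cons (b + 1) fun i => inp i.succ)) (b + 3) (b + 4)
    (fun i => by
      refine Fin.cases ?_ (fun i => Fin.cases ?_ (fun i => ?_) i) i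
      · simp
      · simp
      · have := h1 i.succ; simp only [Fin.cons_succ]; omega) (by omega)
    (fun i => by
      refine Fin.cases ?_ (fun i => Fin.cases ?_ (fun i => ?_) i) i
      · simp
      · simp
      · have := h1 i.succ; simp only [Fin.cons_succ]; omega)
  refine ⟨.seq P (.seq (copyP (inp 0) (b + 2) (b + 3)) (.seq
    (.loop (b + 2) (.seq Q (.seq (clearP (b + 1)) (.seq (moveP (b + 3) (b + 1)) (.inc b)))))
    (.seq (moveP (b + 1) o) (clearP b)))), fun σ hσ τ => ?_⟩
  let v : List.Vector ℕ n := List.Vector.ofFn fun i => σ (inp i.succ)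
  let r : ℕ → ℕ := fun k => k.rec (f v) fun y IH => g (y ::ᵥ IH ::ᵥ v)
  let h : ℕ → Regs := fun k => Function.update (Function.update (Function.update σ b k) (b + 1) (r k))
    (b + 2) (σ (inp 0) - k)
  have hv : (List.Vector.ofFn fun i => σ (inp i)) = σ (inp 0) ::ᵥ v := by
    rw [List.Vector.ofFn]
  have e0 := hσ b (by omega)
  have e1 := hσ (b + 1) (by omega)
  have e2 := hσ (b + 2) (by omega)
  have e3 := hσ (b + 3) (by omega)
  have hbody : ∀ k < σ (inp 0), ∀ τ, Exec (.seq Q (.seq (clearP (b + 1)) (.seq (moveP (b + 3) (b + 1)) (.inc b))))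
      (Function.update (h k) (b + 2) (σ (inp 0) - k - 1)) τ ↔ τ = h (k + 1) := by
    intro k hk τ
    have hin : (List.Vector.ofFn fun i => (Function.update (h k) (b + 2) (σ (inp 0) - k - 1))
        ((Fin.cons b (Fin.cons (b + 1) fun i => inp i.succ) : Fin (n + 2) → ℕ) i)) = k ::ᵥ r k ::ᵥ v := by
      rw [List.Vector.ofFn, List.Vector.ofFn]
      congr 1
      · simp [h]
      congr 1
      · simp [h]
      congr 1
      funext i
      have := h1 i.succ
      simp only [Fin.cons_succ, h, Function.update_apply]
      split_ifs <;> first | omega | rfl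
    have hz : ∀ j, b + 4 ≤ j → (Function.update (h k) (b + 2) (σ (inp 0) - k - 1)) j = 0 := by
      intro j hj
      have := hσ j (by omega)
      simp only [h, Function.update_apply]
      split_ifs <;> omega
    have hr : r (k + 1) = g (k ::ᵥ r k ::ᵥ v) := rfl
    simp only [exec_seq, hQ _ hz, hin, Part.mem_some_iff, exists_eq_left, exec_clear,
      exec_move (b + 3) (b + 1) (by omega), exec_inc]
    refine Eq.congr_right ?_
    funext j
    simp only [h, hr, Function.update_apply]
    generalize g (k ::ᵥ r k ::ᵥ v) = G
    split_ifs <;> first | omega | rfl | grind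
  have hloop := loop_det (b + 2) _ (σ (inp 0)) h (fun k _ => by simp [h]) hbody
  have hstart : Function.update (Function.update σ (b + 1) (σ (b + 1) + f v)) (b + 2)
      (Function.update σ (b + 1) (σ (b + 1) + f v) (b + 2) + Function.update σ (b + 1) (σ (b + 1) + f v) (inp 0)) = h 0 := by
    have : r 0 = f v := rfl
    funext j
    simp only [h, this, Function.update_apply]
    split_ifs <;> first | omega | rfl | grind
  have hin : (List.Vector.ofFn fun i : Fin n => σ (inp i.succ)) = v := rfl
  simp only [exec_seq, hP σ (fun j hj => hσ j (by omega)), hin, Part.mem_some_iff, exists_eq_left]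
  rw [hv]
  simp only [List.Vector.head_cons, List.Vector.tail_cons]
  simp only [exec_copy (inp 0) (b + 2) (b + 3) (by omega) (by omega) (by omega)
    (Function.update σ (b + 1) (σ (b + 1) + f v)) _ (by simp [e3]), exists_eq_left, hstart, hloop,
    exec_move (b + 1) o (by omega), exec_clear]
  refine Eq.congr_right ?_
  change _ = Function.update σ o (σ o + r (σ (inp 0)))
  funext j
  simp only [h, Function.update_apply]
  generalize r (σ (inp 0)) = G
  split_ifs <;> first | omega | rfl | grind

theorem comp_rfind {n : ℕ} (f : List.Vector ℕ (n + 1) → ℕ) (hf : Comp (fun v => Part.some (f v))) :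
    Comp (fun v => Nat.rfind fun k => Part.some (decide (f (k ::ᵥ v) = 0))) := by
  intro inp o b h1 h2 h3
  obtain ⟨P, hP⟩ := hf (Fin.cons b inp) (b + 1) (b + 2) (fun i => by
      refine Fin.cases ?_ (fun i => ?_) i
      · simp
      · have := h1 i; simp only [Fin.cons_succ]; omega) (by omega)
    (fun i => by
      refine Fin.cases ?_ (fun i => ?_) i
      · simp
      · have := h1 i; simp only [Fin.cons_succ]; omega)
  refine ⟨.seq P (.seq (.loop (b + 1) (.seq (clearP (b + 1)) (.seq (.inc b) P))) (moveP b o)), fun σ hσ τ => ?_⟩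
  let v : List.Vector ℕ n := List.Vector.ofFn fun i => σ (inp i)
  let h : ℕ → Regs := fun k => Function.update (Function.update σ b k) (b + 1) (f (k ::ᵥ v))
  have e0 := hσ b (by omega)
  have e1 := hσ (b + 1) (by omega)
  have hPk : ∀ k τ, Exec P (Function.update σ b k) τ ↔ τ = h k := by
    intro k τ
    have hin : (List.Vector.ofFn fun i => (Function.update σ b k) ((Fin.cons b inp : Fin (n + 1) → ℕ) i)) = k ::ᵥ v := by
      rw [List.Vector.ofFn]
      congr 1
      · simp
      congr 1
      funext i
      have := h1 i
      simp only [Fin.cons_succ, Function.update_apply]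
      split_ifs <;> first | omega | rfl
    have hz : ∀ j, b + 2 ≤ j → (Function.update σ b k) j = 0 := by
      intro j hj
      have := hσ j (by omega)
      simp only [Function.update_apply]
      split_ifs <;> omega
    simp only [hP _ hz, hin, Part.mem_some_iff, exists_eq_left]
    refine Eq.congr_right ?_
    funext j
    simp only [h, Function.update_apply]
    split_ifs <;> omega
  have hbody : ∀ k x τ, Exec (.seq (clearP (b + 1)) (.seq (.inc b) P)) (Function.update (h k) (b + 1) x) τ ↔ τ = h (k + 1) := by
    intro k x τ
    simp only [exec_seq, exec_clear, exec_inc, exists_eq_left]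
    rw [← hPk]
    have : ∀ σ₁ σ₂ : Regs, σ₁ = σ₂ → (Exec P σ₁ τ ↔ Exec P σ₂ τ) := by rintro _ _ rfl; rfl
    apply this
    funext j
    simp only [h, Function.update_apply]
    split_ifs <;> first | omega | grind
  have hh : ∀ k, h k (b + 1) = f (k ::ᵥ v) := fun k => by simp [h]
  have hloop1 : ∀ (ρ τ : Regs), LoopRel (b + 1) (Exec (.seq (clearP (b + 1)) (.seq (.inc b) P))) ρ τ → ∀ k, ρ = h k →
      ∃ m, k ≤ m ∧ f (m ::ᵥ v) = 0 ∧ (∀ j, k ≤ j → j < m → f (j ::ᵥ v) ≠ 0) ∧ τ = h m := by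
    intro ρ τ hl
    induction hl with
    | done ρ h0 =>
      rintro k rfl
      exact ⟨k, le_rfl, by rw [← hh]; exact h0, fun j _ _ => by omega, rfl⟩
    | step ρ τ υ h0 he _ ih =>
      rintro k rfl
      rw [hbody] at he
      obtain ⟨m, a1, a2, a3, a4⟩ := ih (k + 1) he
      refine ⟨m, by omega, a2, fun j hj1 hj2 => ?_, a4⟩
      by_cases hjk : j = k
      · subst hjk; rw [← hh]; omega
      · exact a3 j (by omega) hj2
  have hloop2 : ∀ d k m, k + d = m → f (m ::ᵥ v) = 0 → (∀ j, k ≤ j → j < m → f (j ::ᵥ v) ≠ 0) →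
      LoopRel (b + 1) (Exec (.seq (clearP (b + 1)) (.seq (.inc b) P))) (h k) (h m) := by
    intro d
    induction d with
    | zero =>
      intro k m hkm h0 _
      have : k = m := by omega
      subst this
      exact LoopRel.done _ (by rw [hh, h0])
    | succ d ih =>
      intro k m hkm h0 hj
      refine LoopRel.step _ (h (k + 1)) _ ?_ ((hbody _ _ _).2 rfl) (ih (k + 1) m (by omega) h0 (fun j a c => hj j (by omega) c))
      rw [hh]
      exact Nat.pos_of_ne_zero (hj k le_rfl (by omega))
  have hstart : ∀ τ, Exec P σ τ ↔ τ = h 0 := by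
    intro τ
    rw [← hPk]
    have : σ = Function.update σ b 0 := by rw [← e0]; simp
    rw [← this]
  have hfin : ∀ m, Function.update (Function.update (h m) b 0) o (h m o + h m b) =
      Function.update (Function.update σ o (σ o + m)) (b + 1) (f (m ::ᵥ v)) := by
    intro m
    funext j
    simp only [h, Function.update_apply]
    split_ifs <;> first | omega | rfl | grind
  have hfin2 : ∀ m, f (m ::ᵥ v) = 0 → Function.update (Function.update (h m) b 0) o (h m o + h m b) =
      Function.update σ o (σ o + m) := by
    intro m hm
    rw [hfin, hm]
    funext j
    simp only [Function.update_apply]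
    split_ifs <;> first | omega | grind
  have hin : (List.Vector.ofFn fun i : Fin n => σ (inp i)) = v := rfl
  simp only [exec_seq, hstart, exists_eq_left, exec_move b o (by omega), hin]
  constructor
  · rintro ⟨υ, hl, rfl⟩
    obtain ⟨m, _, a2, a3, rfl⟩ := hloop1 _ _ hl 0 rfl
    refine ⟨m, ?_, hfin2 m a2⟩
    refine Nat.mem_rfind.2 ⟨by simp [a2], fun {j} hj => ?_⟩
    simpa using a3 j (by omega) hj
  · rintro ⟨m, hm, rfl⟩
    obtain ⟨a, c⟩ := Nat.mem_rfind.1 hm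
    have a : f (m ::ᵥ v) = 0 := by simpa using a
    refine ⟨h m, hloop2 m 0 m (by omega) a (fun j _ hj => ?_), (hfin2 m a).symm⟩
    simpa using c hj

theorem comp_prim {n : ℕ} {f : List.Vector ℕ n → ℕ} (h : Nat.Primrec' f) : Comp (fun v => Part.some (f v)) := by
  induction h with
  | zero => exact comp_zero
  | succ => exact comp_succ
  | get i => exact comp_get i
  | @comp m n f g _ _ ihf ihg =>
    have := comp_comp _ (fun i v => Part.some (g i v)) ihf ihg
    refine Eq.mp (congrArg Comp ?_) this
    funext v
    have e : (List.Vector.mOfFn fun i => Part.some (g i v)) = Part.some (List.Vector.ofFn fun i => g i v) := by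
      exact List.Vector.mOfFn_pure _
    rw [e]
    exact (Part.bind_some _ _)
  | prec _ _ ihf ihg => exact comp_prec _ _ ihf ihg

theorem comp_partrec {n : ℕ} {f : List.Vector ℕ n →. ℕ} (h : Nat.Partrec' f) : Comp f := by
  induction h with
  | prim h => exact comp_prim h
  | comp g _ _ ihf ihg => exact comp_comp _ g ihf ihg
  | rfind _ ih => exact comp_rfind _ ih

/-- One step of the search for a branch: extend the list by a guessed number. -/
theorem exists_step_program (B : ℕ → Prop) (hB : Sigma11 B) :
    ∃ (P : Prog) (g : ℕ → ℕ), Computable g ∧ ∀ n, B n ↔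
      ∃ σ : ℕ → Regs, σ 0 = init (g n) ∧ ∀ k, Exec P (σ k) (σ (k + 1)) := by
  obtain ⟨R, ⟨hdec, hR⟩, hBR⟩ := hB
  let F : ℕ → ℕ →. ℕ := fun s a => (Encodable.decode (α := ℕ × List ℕ) s : Part (ℕ × List ℕ)).bind fun q =>
    bif decide (R q) then Part.some (Encodable.encode (q.1, q.2 ++ [a])) else Part.none
  have hF : Partrec₂ F := by
    refine Partrec.bind (Computable.ofOption (Computable.decode.comp Computable.fst)) ?_
    refine Partrec.cond (hR.comp Computable.snd) ?_ Partrec.none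
    refine Computable.encode.comp ?_
    refine Computable.pair (Computable.fst.comp Computable.snd) ?_
    exact Computable.list_concat.comp (Computable.snd.comp Computable.snd)
      (Computable.snd.comp Computable.fst)
  have hC := comp_partrec (Nat.Partrec'.part_iff₂.2 hF)
  obtain ⟨Q, hQ⟩ := hC ![0, 1] 2 3 (by intro i; fin_cases i <;> simp) (by omega) (by intro i; fin_cases i <;> simp)
  let P : Prog := .seq (.guess 1) (.seq Q (.seq (clearP 0) (.seq (clearP 1) (moveP 2 0))))
  have hP : ∀ s τ, Exec P (init s) τ ↔ ∃ a, ∃ y ∈ F s a, τ = init y := by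
    intro s τ
    have hz : ∀ a, ∀ j, 3 ≤ j → (Function.update (init s) 1 (init s 1 + a)) j = 0 := by
      intro a j hj
      simp only [init, Function.update_apply]
      split_ifs <;> omega
    have hs0 : ∀ a, (Function.update (init s) 1 (init s 1 + a)) 0 = s := by intro a; simp [init]
    have hs1 : ∀ a, (Function.update (init s) 1 (init s 1 + a)) 1 = a := by intro a; simp [init]
    have hfin : ∀ a y, Function.update (Function.update (Function.update (Function.update
        (Function.update (Function.update (init s) 1 (init s 1 + a)) 2 (Function.update (init s) 1 (init s 1 + a) 2 + y)) 0 0) 1 0) 2 0) 0 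
        ((Function.update (Function.update
        (Function.update (Function.update (init s) 1 (init s 1 + a)) 2 (Function.update (init s) 1 (init s 1 + a) 2 + y)) 0 0) 1 0) 0 + 
        (Function.update (Function.update
        (Function.update (Function.update (init s) 1 (init s 1 + a)) 2 (Function.update (init s) 1 (init s 1 + a) 2 + y)) 0 0) 1 0) 2)  = init y := by
      intro a y
      funext j
      by_cases h0 : j = 0
      · subst h0; simp [init]
      by_cases h1 : j = 1
      · subst h1; simp [init]
      by_cases h2 : j = 2
      · subst h2; simp [init]
      simp [init, h0, h1, h2]
    constructor
    · rintro ⟨υ, ⟨a, rfl⟩, υ', he, he'⟩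
      rw [hQ _ (hz a)] at he
      obtain ⟨y, hy, rfl⟩ := he
      simp only [exec_seq, exec_clear, exists_eq_left, exec_move 2 0 (by omega), hfin] at he'
      refine ⟨a, y, ?_, he'⟩
      simpa [init] using hy
    · rintro ⟨a, y, hy, rfl⟩
      refine ⟨_, ⟨a, rfl⟩, _, (hQ _ (hz a) _).2 ⟨y, ?_, rfl⟩, ?_⟩
      · simpa [init] using hy
      · simp only [exec_seq, exec_clear, exists_eq_left, exec_move 2 0 (by omega), hfin]
  have hFmem : ∀ n l a y, y ∈ F (Encodable.encode ((n, l) : ℕ × List ℕ)) a ↔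
      R (n, l) ∧ y = Encodable.encode ((n, l ++ [a]) : ℕ × List ℕ) := by
    intro n l a y
    simp only [F, Encodable.encodek]
    by_cases h : R (n, l)
    · simp [h]
    · simp [h]
  refine ⟨P, fun n => Encodable.encode ((n, []) : ℕ × List ℕ), ?_, fun n => ?_⟩
  · exact Computable.encode.comp (Computable.pair Computable.id (Computable.const []))
  rw [hBR]
  constructor
  · rintro ⟨f, hf⟩
    refine ⟨fun k => init (Encodable.encode ((n, (List.range k).map f) : ℕ × List ℕ)), rfl, fun k => ?_⟩
    rw [hP]
    refine ⟨f k, _, (hFmem _ _ _ _).2 ⟨hf k, rfl⟩, ?_⟩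
    simp [List.range_succ]
  · rintro ⟨σ, h0, hs⟩
    have key : ∀ k l, σ k = init (Encodable.encode ((n, l) : ℕ × List ℕ)) → ∃ a, R (n, l) ∧
        σ (k + 1) = init (Encodable.encode ((n, l ++ [a]) : ℕ × List ℕ)) := by
      intro k l hk
      have := hs k
      rw [hk, hP] at this
      obtain ⟨a, y, hy, he⟩ := this
      rw [hFmem] at hy
      exact ⟨a, hy.1, by rw [he, hy.2]⟩
    choose! f hf1 hf2 using key
    let l : ℕ → List ℕ := fun k => Nat.rec [] (fun k l => l ++ [f k l]) k
    have hl : ∀ k, l (k + 1) = l k ++ [f k (l k)] := fun k => rfl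
    have hσ : ∀ k, σ k = init (Encodable.encode ((n, l k) : ℕ × List ℕ)) := by
      intro k
      induction k with
      | zero => exact h0
      | succ k ih => rw [hf2 k _ ih, hl]
    refine ⟨fun k => f k (l k), fun m => ?_⟩
    have : (List.range m).map (fun k => f k (l k)) = l m := by
      induction m with
      | zero => rfl
      | succ m ih => rw [List.range_succ, List.map_append, ih, hl]; rfl
    rw [this]
    exact hf1 m _ (hσ m)

theorem sigma11_machine (B : ℕ → Prop) (hB : Sigma11 B) :
    ∃ (M : List Instr) (e : ℕ) (g : ℕ → ℕ), Computable g ∧ ∀ n, B n ↔ GoodRun M e (g n) := by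
  obtain ⟨P, g, hg, h⟩ := exists_step_program B hB
  exact ⟨mainM P, 1 + P.size, g, hg, fun n => by rw [h, goodRun_iff]⟩

section SatLemmas
variable {W : Type} {R0 R1 : W → W → Prop} {val : ℕ → W → Prop} {w : W} {φ ψ : BForm}

theorem sat_var (n : ℕ) : BSat R0 R1 val w (.var n) ↔ val n w := Iff.rfl
theorem sat_neg : BSat R0 R1 val w (.neg φ) ↔ ¬ BSat R0 R1 val w φ := Iff.rfl
theorem sat_and : BSat R0 R1 val w (.and φ ψ) ↔ BSat R0 R1 val w φ ∧ BSat R0 R1 val w ψ := Iff.rfl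
theorem sat_dia0 : BSat R0 R1 val w (.dia0 φ) ↔ ∃ v, R0 w v ∧ BSat R0 R1 val v φ := Iff.rfl
theorem sat_dia1 : BSat R0 R1 val w (.dia1 φ) ↔ ∃ v, R1 w v ∧ BSat R0 R1 val v φ := Iff.rfl
theorem sat_imp : BSat R0 R1 val w (.imp φ ψ) ↔ (BSat R0 R1 val w φ → BSat R0 R1 val w ψ) := by
  simp only [BForm.imp, sat_neg, sat_and]; tauto
theorem sat_bot : BSat R0 R1 val w .bot ↔ False := by
  simp only [BForm.bot, sat_neg, sat_and]; tauto
theorem sat_top : BSat R0 R1 val w .top ↔ True := by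
  simp only [BForm.top, sat_neg, sat_bot]; tauto
theorem sat_box0 : BSat R0 R1 val w (.box0 φ) ↔ ∀ v, R0 w v → BSat R0 R1 val v φ := by
  simp only [BForm.box0, sat_neg, sat_dia0]; push Not; rfl
theorem sat_box1 : BSat R0 R1 val w (.box1 φ) ↔ ∀ v, R1 w v → BSat R0 R1 val v φ := by
  simp only [BForm.box1, sat_neg, sat_dia1]; push Not; rfl

def bOr (φ ψ : BForm) : BForm := .neg (.and (.neg φ) (.neg ψ))
theorem sat_or : BSat R0 R1 val w (bOr φ ψ) ↔ BSat R0 R1 val w φ ∨ BSat R0 R1 val w ψ := by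
  simp only [bOr, sat_neg, sat_and]; tauto

def bigOr : List BForm → BForm
  | [] => .bot
  | φ :: l => bOr φ (bigOr l)
def bigAnd : List BForm → BForm
  | [] => .top
  | φ :: l => .and φ (bigAnd l)
theorem sat_bigOr (l : List BForm) : BSat R0 R1 val w (bigOr l) ↔ ∃ φ ∈ l, BSat R0 R1 val w φ := by
  induction l with
  | nil => simp [bigOr, sat_bot]
  | cons a l ih => simp [bigOr, sat_or, ih]
theorem sat_bigAnd (l : List BForm) : BSat R0 R1 val w (bigAnd l) ↔ ∀ φ ∈ l, BSat R0 R1 val w φ := by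
  induction l with
  | nil => simp [bigAnd, sat_top]
  | cons a l ih => simp [bigAnd, sat_and, ih]

end SatLemmas

/-! ## Frame properties -/

def axTrans : BForm := .imp (.dia0 (.dia0 (.var 0))) (.dia0 (.var 0))
def axConn : BForm := .imp (.and (.dia0 (.var 0)) (.dia0 (.var 1)))
  (bOr (.dia0 (.and (.var 0) (.var 1))) (bOr (.dia0 (.and (.var 0) (.dia0 (.var 1))))
    (.dia0 (.and (.var 1) (.dia0 (.var 0))))))
def axDstep : BForm := .imp (.var 0) (.dia0 (.and (.neg (.var 0)) (.dia0 (.var 0))))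
def axDisc : BForm := .neg (.and (.and (.var 0) (.and axDstep (.box0 axDstep)))
  (.dia0 (.and (.neg (.var 0)) (.box0 (.neg (.var 0))))))
def axSym : BForm := .imp (.var 0) (.box1 (.dia1 (.var 0)))
def axPT : BForm := .imp (.dia1 (.dia1 (.var 0))) (bOr (.var 0) (.dia1 (.var 0)))

theorem axTrans_mem : axTrans ∈ DisK43 := by
  refine ⟨by simp [axTrans, BForm.imp, BForm.OnlyDia0], fun T R _ hW _ val w => ?_⟩
  simp only [axTrans, sat_imp, sat_dia0]
  rintro ⟨v, h1, u, h2, h3⟩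
  exact ⟨u, hW.1 _ _ _ h1 h2, h3⟩

theorem axConn_mem : axConn ∈ DisK43 := by
  refine ⟨by simp [axConn, BForm.imp, bOr, BForm.OnlyDia0], fun T R _ hW _ val w => ?_⟩
  simp only [axConn, sat_imp, sat_dia0, sat_or, sat_and]
  rintro ⟨⟨y, h1, h2⟩, ⟨z, h3, h4⟩⟩
  rcases hW.2 _ _ _ h1 h3 with rfl | h | h
  · exact Or.inl ⟨y, h1, h2, h4⟩
  · exact Or.inr (Or.inl ⟨y, h1, h2, z, h, h4⟩)
  · exact Or.inr (Or.inr ⟨z, h3, h4, y, h, h2⟩)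

theorem axDisc_mem : axDisc ∈ DisK43 := by
  refine ⟨by simp [axDisc, axDstep, BForm.box0, BForm.imp, BForm.OnlyDia0], fun T R _ hW hD val w => ?_⟩
  simp only [axDisc, axDstep, sat_neg, sat_and, sat_imp, sat_dia0, sat_box0, sat_var]
  rintro ⟨⟨hp, hs0, hs⟩, e, he, hne, hbe⟩
  apply hD
  let p := val 0
  let Inv : T → Prop := fun v => (w = v ∨ R w v) ∧ (p v ∨ ∃ u, R v u ∧ p u)
  have hstep : ∀ v, Inv v → ∃ v', Inv v' ∧ R v v' ∧ (p v' ↔ ¬ p v) := by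
    rintro v ⟨hwv, hv⟩
    by_cases hpv : p v
    · have : ∃ u, R v u ∧ ¬ p u ∧ ∃ u', R u u' ∧ p u' := by
        rcases hwv with rfl | h
        · exact hs0 hpv
        · exact hs v h hpv
      obtain ⟨u, h1, h2, h3⟩ := this
      refine ⟨u, ⟨Or.inr ?_, Or.inr h3⟩, h1, by tauto⟩
      rcases hwv with rfl | h
      · exact h1
      · exact hW.1 _ _ _ h h1
    · obtain ⟨u, h1, h2⟩ := hv.resolve_left hpv
      refine ⟨u, ⟨Or.inr ?_, Or.inl h2⟩, h1, by tauto⟩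
      rcases hwv with rfl | h
      · exact h1
      · exact hW.1 _ _ _ h h1
  have hpe : ∀ v, (w = v ∨ R w v) → p v → R v e := by
    rintro v (rfl | h) hv
    · exact he
    · rcases hW.2 _ _ _ h he with rfl | h' | h'
      · exact absurd hv hne
      · exact h'
      · exact absurd hv (hbe v h')
  have hIe : ∀ v, Inv v → R v e ∧ ¬ R e v := by
    rintro v ⟨hwv, hv⟩
    by_cases hpv : p v
    · exact ⟨hpe v hwv hpv, fun h => hbe v h hpv⟩
    · obtain ⟨u, h1, h2⟩ := hv.resolve_left hpv
      have hwu : R w u := by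
        rcases hwv with rfl | h
        · exact h1
        · exact hW.1 _ _ _ h h1
      exact ⟨hW.1 _ _ _ h1 (hpe u (Or.inr hwu) h2), fun h => hbe u (hW.1 _ _ _ h h1) h2⟩
  choose! f hf1 hf2 hf3 using hstep
  have hI : ∀ k, Inv (f^[k] w) := by
    intro k
    induction k with
    | zero => exact ⟨Or.inl rfl, Or.inl hp⟩
    | succ k ih => rw [Function.iterate_succ_apply']; exact hf1 _ ih
  refine ⟨fun k => f^[k] w, e, fun k => ?_, fun k => ?_, fun k => (hIe _ (hI k)).1, fun k => (hIe _ (hI k)).2⟩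
  · simp only [Function.iterate_succ_apply']; exact hf2 _ (hI k)
  · simp only [Function.iterate_succ_apply']
    intro h
    have := hf3 _ (hI k)
    rw [← h] at this
    tauto

theorem axSym_mem : axSym ∈ DiffLogic := by
  refine ⟨by simp [axSym, BForm.imp, BForm.box1, BForm.OnlyDia1], fun D _ val w => ?_⟩
  simp only [axSym, sat_imp, sat_dia1, sat_box1]
  intro h v hv
  exact ⟨w, hv.symm, h⟩

theorem axPT_mem : axPT ∈ DiffLogic := by
  refine ⟨by simp [axPT, BForm.imp, bOr, BForm.OnlyDia1], fun D _ val w => ?_⟩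
  simp only [axPT, sat_imp, sat_dia1, sat_or]
  rintro ⟨v, h1, u, h2, h3⟩
  by_cases h : w = u
  · subst h; exact Or.inl h3
  · exact Or.inr ⟨u, h, h3⟩

theorem disK43_sub (L1 : Set BForm) (h1 : L1 = LogOmega ∨ L1 = GL3 ∨ L1 = DisK43) : DisK43 ⊆ L1 := by
  rcases h1 with rfl | rfl | rfl
  · rintro φ ⟨h, h2⟩
    refine ⟨h, h2 ℕ _ ⟨0⟩ ⟨fun x y z => lt_trans, fun x y z _ _ => ?_⟩ ?_⟩
    · omega
    · rintro ⟨x, xw, h1, _, h2, _⟩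
      have : ∀ i, i ≤ x i := by
        intro i
        induction i with
        | zero => omega
        | succ i ih => have := h1 i; omega
      have a := this xw
      have b := h2 xw
      omega
  · rintro φ ⟨h, h2⟩
    refine ⟨h, fun T R hne hl hn => h2 T R hne ⟨hl.2.1, fun x y z _ _ => ?_⟩ ?_⟩
    · rcases hl.2.2 y z with h | h | h <;> tauto
    · rintro ⟨x, xw, h1, h2, _⟩
      exact hn ⟨x, h1, h2⟩
  · exact fun _ h => h

structure FrameProps {W : Type} (R0 R1 : W → W → Prop) : Prop where
  trans : ∀ x y z, R0 x y → R0 y z → R0 x z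
  conn : ∀ x y z, R0 x y → R0 x z → y = z ∨ R0 y z ∨ R0 z y
  disc : ∀ (p : W → Prop) w e, p w → (∀ v, (w = v ∨ R0 w v) → p v → ∃ u, R0 v u ∧ ¬ p u ∧ ∃ u', R0 u u' ∧ p u') →
    R0 w e → ¬ p e → ∃ u, R0 e u ∧ p u
  sym : ∀ x y, R1 x y → R1 y x
  pt : ∀ x y z, R1 x y → R1 y z → x = z ∨ R1 x z
  lcom : ∀ x y z, R0 x y → R1 y z → ∃ u, R1 x u ∧ R0 u z
  rcom : ∀ x y z, R1 x y → R0 y z → ∃ u, R0 x u ∧ R1 u z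
  conf : ∀ x y z, R0 x y → R1 x z → ∃ u, R1 y u ∧ R0 z u

theorem frameProps (F : Frame2) (h0 : ∀ φ ∈ DisK43, F.Valid φ) (h1 : ∀ φ ∈ DiffLogic, F.Valid φ)
    (c1 : F.Valid commAx1) (c2 : F.Valid commAx2) (c3 : F.Valid commAx3) : FrameProps F.R0 F.R1 where
  trans x y z hxy hyz := by
    have := h0 _ axTrans_mem (fun _ v => v = z) x
    simp only [axTrans, sat_imp, sat_dia0, sat_var] at this
    obtain ⟨v, h, rfl⟩ := this ⟨y, hxy, z, hyz, rfl⟩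
    exact h
  conn x y z hxy hxz := by
    have := h0 _ axConn_mem (fun k v => if k = 0 then v = y else v = z) x
    simp only [axConn, sat_imp, sat_dia0, sat_var, sat_or, sat_and, if_true, one_ne_zero, if_false] at this
    rcases this ⟨⟨y, hxy, rfl⟩, ⟨z, hxz, rfl⟩⟩ with ⟨v, _, rfl, h⟩ | ⟨v, _, rfl, u, h, rfl⟩ | ⟨v, _, rfl, u, h, rfl⟩
    · exact Or.inl h
    · exact Or.inr (Or.inl h)
    · exact Or.inr (Or.inr h)
  disc p w e hp hs he hne := by
    have := h0 _ axDisc_mem (fun _ v => p v) w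
    simp only [axDisc, axDstep, sat_neg, sat_and, sat_imp, sat_dia0, sat_box0, sat_var] at this
    by_contra hcon
    push Not at hcon
    exact this ⟨⟨hp, fun h => hs w (Or.inl rfl) h, fun v hv h => hs v (Or.inr hv) h⟩, e, he, hne, hcon⟩
  sym x y hxy := by
    have := h1 _ axSym_mem (fun _ v => v = x) x
    simp only [axSym, sat_imp, sat_dia1, sat_var, sat_box1] at this
    obtain ⟨v, h, rfl⟩ := this trivial y hxy
    exact h
  pt x y z hxy hyz := by
    have := h1 _ axPT_mem (fun _ v => v = z) x
    simp only [axPT, sat_imp, sat_dia1, sat_var, sat_or] at this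
    rcases this ⟨y, hxy, z, hyz, rfl⟩ with rfl | ⟨v, h, rfl⟩
    · exact Or.inl rfl
    · exact Or.inr h
  lcom x y z hxy hyz := by
    have := c1 (fun _ v => v ≠ z) x
    simp only [commAx1, sat_imp, sat_box0, sat_box1, sat_var] at this
    by_contra hcon
    push Not at hcon
    exact this (fun v hv u hu e => hcon v hv (e ▸ hu)) y hxy z hyz rfl
  rcom x y z hxy hyz := by
    have := c2 (fun _ v => v ≠ z) x
    simp only [commAx2, sat_imp, sat_box0, sat_box1, sat_var] at this
    by_contra hcon
    push Not at hcon
    exact this (fun v hv u hu e => hcon v hv (e ▸ hu)) y hxy z hyz rfl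
  conf x y z hxy hxz := by
    have := c3 (fun _ v => F.R1 y v) x
    simp only [commAx3, sat_imp, sat_dia0, sat_dia1, sat_box0, sat_box1, sat_var] at this
    obtain ⟨v, h1, h2⟩ := this ⟨y, hxy, fun v hv => hv⟩ z hxz
    exact ⟨v, h2, h1⟩

/-! ## The formula -/

def insAt (M : List Instr) (j : ℕ) : Instr := M.getD j (0, Op.nop, 0)

def vN : BForm := .var 0
def vD : BForm := .var 1
def vP : BForm := .var 2

def lamF (j : ℕ) : BForm := .and (.var (3 + j)) (bigAnd ((List.range j).map fun i => .neg (.var (3 + i))))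

open Classical in
/-- "the label satisfies `S` and `f` of the label holds". -/
noncomputable def selWith (M : List Instr) (S : Instr → Prop) (f : Instr → BForm) : BForm :=
  bigOr (((List.range M.length).filter fun j => decide (S (insAt M j))).map fun j => .and (lamF j) (f (insAt M j)))

noncomputable def sel (M : List Instr) (S : Instr → Prop) : BForm := selWith M S fun _ => .top

def diaP1 (φ : BForm) : BForm := bOr φ (.dia1 φ)

def gl (φ : BForm) : BForm := .boxP1 (.box0 φ)

open Classical in
noncomputable def predF (M : List Instr) (x : Instr) : BForm :=
  bOr (if x.1 = 0 then .boxP1 (.box0 (.neg vN)) else .bot)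
    (bOr (.and vP (.dia1 (.and (.dia0 (.and vN (.and (.neg vP) (sel M fun y => y.2.2 = x.1))))
        (.box0 (.box0 (.neg vN))))))
      (.and (.neg vP) (.dia1 (.and (.dia0 (.and vN (.and vP (sel M fun y => y.2.2 = x.1))))
        (.box0 (.box0 (.neg vN)))))))

noncomputable def opF (M : List Instr) : Op → BForm
  | .inc _ => .top
  | .nop => .top
  | .dec _ => .dia1 vD
  | .zero i => .box1 (.imp (.dia0 (.and vN (sel M fun y => y.2.1 = .inc i))) (.dia0 vD))

noncomputable def killF (M : List Instr) : Op → BForm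
  | .dec i => .dia0 (.and vN (sel M fun y => y.2.1 = .inc i))
  | _ => .bot

noncomputable def f1 : BForm := gl (.imp vN (.and (.box1 (.neg vN)) (.box0 (.neg vN))))
noncomputable def f2 : BForm := diaP1 (.dia0 vN)
noncomputable def f3 (M : List Instr) : BForm :=
  gl (.imp vN (selWith M (fun _ => True) fun x => .and (predF M x) (opF M x.2.1)))
open Classical in
noncomputable def f4 (M : List Instr) : BForm :=
  gl (.imp vD (.and (.box1 (.neg vD)) (.and (.box0 (.neg vD))
    (bigOr (M.map fun x => .and (.dia1 (.and vN (sel M fun y => y = x))) (killF M x.2.1))))))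
noncomputable def f5 (M : List Instr) (e : ℕ) : BForm :=
  .boxP1 (.imp (.dia0 vN) (.dia0 (.and (.dia0 vN) (.dia1 (.and vN (sel M fun x => x.1 = e))))))
noncomputable def f6 : BForm := gl (.imp vN (.dia0 (.boxP1 (.and (.neg vN) (.box0 (.neg vN))))))
def hF : ℕ → BForm
  | 0 => .top
  | k + 1 => .dia0 (.and (diaP1 vN) (hF k))
noncomputable def f7 (M : List Instr) (n : ℕ) : BForm :=
  gl (.imp (.and vN (sel M fun x => x = (0, Op.nop, 1))) (.and (hF n) (.neg (hF (n + 1)))))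

noncomputable def mainF (M : List Instr) (e n : ℕ) : BForm :=
  .and (.and f1 (.and f2 (.and (f3 M) (.and (f4 M) (.and (f5 M e) f6))))) (f7 M n)

/-! ## Its meaning -/

def EqR {W : Type} (R1 : W → W → Prop) (x y : W) : Prop := x = y ∨ R1 x y

def LamS {W : Type} (val : ℕ → W → Prop) (w : W) (j : ℕ) : Prop := val (3 + j) w ∧ ∀ i < j, ¬ val (3 + i) w

/-- World `w` carries the label `x`. -/
def LabS {W : Type} (M : List Instr) (val : ℕ → W → Prop) (w : W) (x : Instr) : Prop :=
  ∃ j < M.length, LamS val w j ∧ insAt M j = x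

def HsS {W : Type} (R0 R1 : W → W → Prop) (N : W → Prop) : ℕ → W → Prop
  | 0, _ => True
  | k + 1, w => ∃ v, R0 w v ∧ (∃ u, EqR R1 v u ∧ N u) ∧ HsS R0 R1 N k v

def Below {W : Type} (R0 R1 : W → W → Prop) (r w : W) : Prop := ∃ ρ, EqR R1 r ρ ∧ R0 ρ w

def opS {W : Type} (R0 R1 : W → W → Prop) (N D : W → Prop) (Lab : W → Instr → Prop) (w : W) : Op → Prop
  | .inc _ => True
  | .nop => True
  | .dec _ => ∃ v, R1 w v ∧ D v
  | .zero i => ∀ v, R1 w v → (∃ z, R0 v z ∧ N z ∧ ∃ y, Lab z y ∧ y.2.1 = .inc i) → ∃ z, R0 v z ∧ D z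

structure Sem {W : Type} (R0 R1 : W → W → Prop) (N D Pr : W → Prop) (Lab : W → Instr → Prop)
    (e n : ℕ) (r : W) : Prop where
  s1 : ∀ w, Below R0 R1 r w → N w → (∀ v, R1 w v → ¬ N v) ∧ ∀ v, R0 w v → ¬ N v
  s2 : ∃ w, Below R0 R1 r w ∧ N w
  s3 : ∀ w, Below R0 R1 r w → N w → ∃ x, Lab w x ∧
    ((x.1 = 0 ∧ ∀ y, EqR R1 w y → ∀ z, R0 y z → ¬ N z) ∨
      ∃ y, R1 w y ∧ (∃ z, R0 y z ∧ N z ∧ (Pr z ↔ ¬ Pr w) ∧ ∃ x', Lab z x' ∧ x'.2.2 = x.1) ∧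
        ∀ z, R0 y z → ∀ z', R0 z z' → ¬ N z') ∧ opS R0 R1 N D Lab w x.2.1
  s4 : ∀ w, Below R0 R1 r w → D w → (∀ v, R1 w v → ¬ D v) ∧ (∀ v, R0 w v → ¬ D v) ∧
    ∃ i, (∃ v, R1 w v ∧ N v ∧ ∃ x, Lab v x ∧ x.2.1 = .dec i) ∧
      ∃ z, R0 w z ∧ N z ∧ ∃ x, Lab z x ∧ x.2.1 = .inc i
  s5 : ∀ ρ, EqR R1 r ρ → (∃ z, R0 ρ z ∧ N z) → ∃ y, R0 ρ y ∧ (∃ z, R0 y z ∧ N z) ∧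
    ∃ v, R1 y v ∧ N v ∧ ∃ x, Lab v x ∧ x.1 = e
  s6 : ∀ w, Below R0 R1 r w → N w → ∃ y, R0 w y ∧ ∀ y', EqR R1 y y' → ¬ N y' ∧ ∀ z, R0 y' z → ¬ N z
  s7 : ∀ w, Below R0 R1 r w → N w → Lab w (0, Op.nop, 1) → HsS R0 R1 N n w ∧ ¬ HsS R0 R1 N (n + 1) w

section Meaning
variable {W : Type} {R0 R1 : W → W → Prop} {val : ℕ → W → Prop}

theorem insAt_mem {M : List Instr} {j : ℕ} (h : j < M.length) : insAt M j ∈ M := by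
  simp [insAt, List.getD, h]

theorem LabS.mem {M : List Instr} {w : W} {x : Instr} (h : LabS M val w x) : x ∈ M := by
  obtain ⟨j, hj, _, rfl⟩ := h
  exact insAt_mem hj

theorem LabS.uniq {M : List Instr} {w : W} {x y : Instr} (h : LabS M val w x) (h' : LabS M val w y) : x = y := by
  obtain ⟨j, hj, a, rfl⟩ := h
  obtain ⟨j', hj', a', rfl⟩ := h'
  have : j = j' := by
    rcases lt_trichotomy j j' with h | h | h
    · exact absurd a.1 (a'.2 _ h)
    · exact h
    · exact absurd a'.1 (a.2 _ h)
  rw [this]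

theorem sat_lamF (w : W) (j : ℕ) : BSat R0 R1 val w (lamF j) ↔ LamS val w j := by
  simp [lamF, LamS, sat_and, sat_bigAnd, sat_var, sat_neg]

theorem sat_selWith (M : List Instr) (S : Instr → Prop) (f : Instr → BForm) (w : W) :
    BSat R0 R1 val w (selWith M S f) ↔ ∃ x, LabS M val w x ∧ S x ∧ BSat R0 R1 val w (f x) := by
  simp only [selWith, sat_bigOr, List.mem_map, List.mem_filter, List.mem_range, decide_eq_true_eq]
  constructor
  · rintro ⟨_, ⟨j, ⟨hj, hS⟩, rfl⟩, h⟩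
    rw [sat_and, sat_lamF] at h
    exact ⟨_, ⟨j, hj, h.1, rfl⟩, hS, h.2⟩
  · rintro ⟨_, ⟨j, hj, h, rfl⟩, hS, h2⟩
    refine ⟨_, ⟨j, ⟨hj, hS⟩, rfl⟩, ?_⟩
    rw [sat_and, sat_lamF]
    exact ⟨h, h2⟩

theorem sat_sel (M : List Instr) (S : Instr → Prop) (w : W) :
    BSat R0 R1 val w (sel M S) ↔ ∃ x, LabS M val w x ∧ S x := by
  simp [sel, sat_selWith, sat_top]

theorem sat_boxP1 (φ : BForm) (w : W) :
    BSat R0 R1 val w (.boxP1 φ) ↔ ∀ v, EqR R1 w v → BSat R0 R1 val v φ := by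
  simp only [BForm.boxP1, sat_and, sat_box1, EqR]
  constructor
  · rintro ⟨a, b⟩ v (rfl | h)
    · exact a
    · exact b v h
  · intro h
    exact ⟨h w (Or.inl rfl), fun v hv => h v (Or.inr hv)⟩

theorem sat_diaP1 (φ : BForm) (w : W) :
    BSat R0 R1 val w (diaP1 φ) ↔ ∃ v, EqR R1 w v ∧ BSat R0 R1 val v φ := by
  simp only [diaP1, sat_or, sat_dia1, EqR]
  constructor
  · rintro (h | ⟨v, a, b⟩)
    · exact ⟨w, Or.inl rfl, h⟩
    · exact ⟨v, Or.inr a, b⟩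
  · rintro ⟨v, rfl | h, a⟩
    · exact Or.inl a
    · exact Or.inr ⟨v, h, a⟩

theorem sat_gl (φ : BForm) (r : W) :
    BSat R0 R1 val r (gl φ) ↔ ∀ w, Below R0 R1 r w → BSat R0 R1 val w φ := by
  simp only [gl, sat_boxP1, sat_box0, Below]
  constructor
  · rintro h w ⟨ρ, a, b⟩; exact h ρ a w b
  · intro h ρ a w b; exact h w ⟨ρ, a, b⟩

theorem sat_hF (k : ℕ) (w : W) : BSat R0 R1 val w (hF k) ↔ HsS R0 R1 (val 0) k w := by
  induction k generalizing w with
  | zero => simp [hF, HsS, sat_top]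
  | succ k ih => simp only [hF, HsS, sat_dia0, sat_and, sat_diaP1, ih, vN, sat_var]

theorem sat_predF (M : List Instr) (x : Instr) (w : W) : BSat R0 R1 val w (predF M x) ↔
    ((x.1 = 0 ∧ ∀ y, EqR R1 w y → ∀ z, R0 y z → ¬ val 0 z) ∨
      ∃ y, R1 w y ∧ (∃ z, R0 y z ∧ val 0 z ∧ (val 2 z ↔ ¬ val 2 w) ∧ ∃ x', LabS M val z x' ∧ x'.2.2 = x.1) ∧
        ∀ z, R0 y z → ∀ z', R0 z z' → ¬ val 0 z') := by
  simp only [predF, sat_or]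
  refine or_congr ?_ ?_
  · split_ifs with h
    · simp [sat_boxP1, sat_box0, sat_neg, vN, sat_var, h]
    · simp [sat_bot, h]
  · simp only [sat_and, sat_dia1, sat_dia0, sat_box0, sat_neg, vN, vP, sat_var, sat_sel]
    by_cases h : val 2 w <;> simp [h]

theorem sat_opF (M : List Instr) (o : Op) (w : W) : BSat R0 R1 val w (opF M o) ↔
    opS R0 R1 (val 0) (val 1) (LabS M val) w o := by
  cases o <;> simp [opF, opS, sat_top, sat_dia1, sat_box1, sat_imp, sat_dia0, sat_and, vN, vD, sat_var, sat_sel]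

theorem sat_mainF (M : List Instr) (e n : ℕ) (r : W) : BSat R0 R1 val r (mainF M e n) ↔
    Sem R0 R1 (val 0) (val 1) (val 2) (LabS M val) e n r := by
  have e1 : BSat R0 R1 val r f1 ↔ ∀ w, Below R0 R1 r w → val 0 w → (∀ v, R1 w v → ¬ val 0 v) ∧ ∀ v, R0 w v → ¬ val 0 v := by
    simp only [f1, sat_gl, sat_imp, sat_and, sat_box0, sat_box1, sat_neg, vN, sat_var]
  have e2 : BSat R0 R1 val r f2 ↔ ∃ w, Below R0 R1 r w ∧ val 0 w := by
    simp only [f2, sat_diaP1, sat_dia0, vN, sat_var, Below]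
    constructor
    · rintro ⟨a, b, c, d, e⟩; exact ⟨c, ⟨a, b, d⟩, e⟩
    · rintro ⟨c, ⟨a, b, d⟩, e⟩; exact ⟨a, b, c, d, e⟩
  have e3 : BSat R0 R1 val r (f3 M) ↔ ∀ w, Below R0 R1 r w → val 0 w → ∃ x, LabS M val w x ∧
    ((x.1 = 0 ∧ ∀ y, EqR R1 w y → ∀ z, R0 y z → ¬ val 0 z) ∨
      ∃ y, R1 w y ∧ (∃ z, R0 y z ∧ val 0 z ∧ (val 2 z ↔ ¬ val 2 w) ∧ ∃ x', LabS M val z x' ∧ x'.2.2 = x.1) ∧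
        ∀ z, R0 y z → ∀ z', R0 z z' → ¬ val 0 z') ∧ opS R0 R1 (val 0) (val 1) (LabS M val) w x.2.1 := by
    simp only [f3, sat_gl, sat_imp, sat_selWith, sat_and, sat_predF, sat_opF, vN, sat_var, true_and]
  have ek : ∀ w, (BSat R0 R1 val w (bigOr (M.map fun x => .and (.dia1 (.and vN (sel M fun y => y = x))) (killF M x.2.1)))) ↔
      ∃ i, (∃ v, R1 w v ∧ val 0 v ∧ ∃ x, LabS M val v x ∧ x.2.1 = .dec i) ∧
      ∃ z, R0 w z ∧ val 0 z ∧ ∃ x, LabS M val z x ∧ x.2.1 = .inc i := by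
    intro w
    simp only [sat_bigOr, List.mem_map]
    constructor
    · rintro ⟨_, ⟨x, hx, rfl⟩, h⟩
      rw [sat_and] at h
      obtain ⟨⟨v, h1, h2, h3⟩, h4⟩ := h
      rw [sat_sel] at h3
      obtain ⟨y, h3, rfl⟩ := h3
      cases ho : y.2.1 with
      | dec i =>
        rw [ho] at h4
        obtain ⟨z, a, b, c⟩ := h4
        rw [sat_sel] at c
        exact ⟨i, ⟨v, h1, h2, y, h3, ho⟩, z, a, b, c⟩
      | _ => rw [ho] at h4; simp only [killF, sat_bot] at h4
    · rintro ⟨i, ⟨v, h1, h2, x, h3, ho⟩, z, a, b, c⟩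
      refine ⟨_, ⟨x, h3.mem, rfl⟩, ?_⟩
      rw [sat_and, ho]
      refine ⟨⟨v, h1, h2, ?_⟩, z, a, b, ?_⟩
      · rw [sat_sel]; exact ⟨x, h3, rfl⟩
      · rw [sat_sel]; exact c
  have e4 : BSat R0 R1 val r (f4 M) ↔ ∀ w, Below R0 R1 r w → val 1 w → (∀ v, R1 w v → ¬ val 1 v) ∧ (∀ v, R0 w v → ¬ val 1 v) ∧
    ∃ i, (∃ v, R1 w v ∧ val 0 v ∧ ∃ x, LabS M val v x ∧ x.2.1 = .dec i) ∧
      ∃ z, R0 w z ∧ val 0 z ∧ ∃ x, LabS M val z x ∧ x.2.1 = .inc i := by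
    simp only [f4, sat_gl, sat_imp, sat_and, sat_box0, sat_box1, sat_neg, vD, sat_var, ek]
  have e5 : BSat R0 R1 val r (f5 M e) ↔ ∀ ρ, EqR R1 r ρ → (∃ z, R0 ρ z ∧ val 0 z) → ∃ y, R0 ρ y ∧ (∃ z, R0 y z ∧ val 0 z) ∧
    ∃ v, R1 y v ∧ val 0 v ∧ ∃ x, LabS M val v x ∧ x.1 = e := by
    simp only [f5, sat_boxP1, sat_imp, sat_and, sat_dia0, sat_dia1, sat_sel, vN, sat_var]
  have e6 : BSat R0 R1 val r f6 ↔ ∀ w, Below R0 R1 r w → val 0 w → ∃ y, R0 w y ∧ ∀ y', EqR R1 y y' → ¬ val 0 y' ∧ ∀ z, R0 y' z → ¬ val 0 z := by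
    simp only [f6, sat_gl, sat_boxP1, sat_imp, sat_and, sat_dia0, sat_box0, sat_neg, vN, sat_var]
  have e7 : BSat R0 R1 val r (f7 M n) ↔ ∀ w, Below R0 R1 r w → val 0 w → LabS M val w (0, Op.nop, 1) → HsS R0 R1 (val 0) n w ∧ ¬ HsS R0 R1 (val 0) (n + 1) w := by
    simp only [f7, sat_gl, sat_imp, sat_and, sat_neg, sat_hF, sat_sel, vN, sat_var, exists_eq_right, and_imp]
  simp only [mainF, sat_and, e1, e2, e3, e4, e5, e6, e7]
  constructor
  · rintro ⟨⟨a1, a2, a3, a4, a5, a6⟩, a7⟩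
    exact ⟨a1, a2, a3, a4, a5, a6, a7⟩
  · rintro ⟨a1, a2, a3, a4, a5, a6, a7⟩
    exact ⟨⟨a1, a2, a3, a4, a5, a6⟩, a7⟩

end Meaning

theorem encodeB_inj : ∀ φ ψ, encodeB φ = encodeB ψ → φ = ψ := by
  intro φ
  induction φ with
  | var n => intro ψ h; cases ψ <;> simp [encodeB, Nat.pair_eq_pair] at h; rw [h]
  | neg φ ih => intro ψ h; cases ψ <;> simp [encodeB, Nat.pair_eq_pair] at h; rw [ih _ h]
  | and φ φ' ih ih' =>
    intro ψ h; cases ψ <;> simp [encodeB, Nat.pair_eq_pair] at h; rw [ih _ h.1, ih' _ h.2]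
  | dia0 φ ih => intro ψ h; cases ψ <;> simp [encodeB, Nat.pair_eq_pair] at h; rw [ih _ h]
  | dia1 φ ih => intro ψ h; cases ψ <;> simp [encodeB, Nat.pair_eq_pair] at h; rw [ih _ h]

theorem computable_form (M : List Instr) (e : ℕ) : Computable fun n => encodeB (mainF M e n) := by
  apply Primrec.to_comp
  have pc : ∀ (c : ℕ) (f : ℕ → ℕ), Primrec f → Primrec fun n => Nat.pair c (f n) :=
    fun c f hf => Primrec₂.natPair.comp (Primrec.const c) hf
  have pp : ∀ (f g : ℕ → ℕ), Primrec f → Primrec g → Primrec fun n => Nat.pair (f n) (g n) :=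
    fun f g hf hg => Primrec₂.natPair.comp hf hg
  have hH : Primrec fun n => encodeB (hF n) := by
    have : Primrec fun n => Nat.rec (motive := fun _ => ℕ) (encodeB .top)
        (fun _ ih => Nat.pair 3 (Nat.pair 2 (Nat.pair (encodeB (diaP1 vN)) ih))) n := by
      refine Primrec.nat_rec₁ _ ?_
      exact Primrec₂.natPair.comp (Primrec.const _) (Primrec₂.natPair.comp (Primrec.const _)
        (Primrec₂.natPair.comp (Primrec.const _) Primrec.snd))
    refine this.of_eq fun n => ?_
    induction n with
    | zero => rfl
    | succ n ih => simp only [hF, encodeB]; rw [← ih]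
  have hH1 : Primrec fun n => encodeB (hF (n + 1)) := hH.comp Primrec.succ
  simp only [mainF, f7, gl, BForm.boxP1, BForm.box0, BForm.box1, BForm.imp, encodeB]
  have inner : Primrec fun n => Nat.pair 1 (Nat.pair 2 (Nat.pair
      (Nat.pair 2 (Nat.pair (encodeB vN) (encodeB (sel M fun x => x = (0, Op.nop, 1)))))
      (Nat.pair 1 (Nat.pair 2 (Nat.pair (encodeB (hF n)) (Nat.pair 1 (encodeB (hF (n + 1))))))))) :=
    pc _ _ (pc _ _ (pp _ _ (Primrec.const _) (pc _ _ (pc _ _ (pp _ _ hH (pc _ _ hH1))))))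
  have inner2 := pc 1 _ (pc 3 _ (pc 1 _ inner))
  exact pc _ _ (pp _ _ (Primrec.const _) (pc _ _ (pp _ _ inner2 (pc _ _ (pc _ _ (pc _ _ inner2))))))

/-! ## Counters from matchings -/

section Counters
open Classical

noncomputable def cnt (op : ℕ → Op) (o : Op) (t : ℕ) : ℕ := ((Finset.range t).filter fun s => op s = o).card

theorem cnt_succ (op : ℕ → Op) (o : Op) (t : ℕ) : cnt op o (t + 1) = cnt op o t + if op t = o then 1 else 0 := by
  simp only [cnt, Finset.range_add_one, Finset.filter_insert]
  split_ifs with h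
  · rw [Finset.card_insert_of_notMem (by simp)]
  · rfl

def opApply : Op → Regs → Regs
  | .inc i, σ => Function.update σ i (σ i + 1)
  | .dec i, σ => Function.update σ i (σ i - 1)
  | _, σ => σ

theorem counters (op : ℕ → Op) (Dm : ℕ → ℕ → Prop)
    (ha : ∀ t i, op t = .dec i → ∃ s, Dm t s)
    (hb : ∀ t s, Dm t s → s < t ∧ ∃ i, op t = .dec i ∧ op s = .inc i)
    (hc : ∀ t t' s, Dm t s → Dm t' s → t = t')
    (hc' : ∀ t s s', Dm t s → Dm t s' → s = s')
    (hd : ∀ t i s, op t = .zero i → s < t → op s = .inc i → ∃ t', t' < t ∧ Dm t' s) :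
    ∃ reg : ℕ → Regs, reg 0 = (fun _ => 0) ∧ ∀ t, opRel (op t) (reg t) (reg (t + 1)) := by
  have h1 : ∀ t i, op t = .dec i → cnt op (.dec i) (t + 1) ≤ cnt op (.inc i) t := by
    intro t i hi
    have : ∀ t', op t' = .dec i → ∃ s, Dm t' s := fun t' h => ha t' i h
    choose! f hf using this
    refine Finset.card_le_card_of_injOn f ?_ ?_
    · intro t' ht'
      simp only [Finset.coe_filter, Finset.mem_range, Set.mem_setOf_eq] at ht' ⊢
      obtain ⟨h1, j, h2, h3⟩ := hb _ _ (hf t' ht'.2)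
      refine ⟨by omega, ?_⟩
      rw [ht'.2] at h2
      cases h2
      exact h3
    · intro a ha' b hb' hab
      simp only [Finset.coe_filter, Finset.mem_range, Set.mem_setOf_eq] at ha' hb'
      exact hc _ _ _ (hf a ha'.2) (hab ▸ hf b hb'.2)
  have h2 : ∀ t i, op t = .zero i → cnt op (.inc i) t ≤ cnt op (.dec i) t := by
    intro t i hi
    have : ∀ s, (s < t ∧ op s = .inc i) → ∃ t', t' < t ∧ Dm t' s := fun s h => hd t i s hi h.1 h.2
    choose! f hf1 hf2 using this
    refine Finset.card_le_card_of_injOn f ?_ ?_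
    · intro t' ht'
      simp only [Finset.coe_filter, Finset.mem_range, Set.mem_setOf_eq] at ht' ⊢
      obtain ⟨h1, j, h2, h3⟩ := hb _ _ (hf2 t' ht')
      refine ⟨hf1 _ ht', ?_⟩
      rw [ht'.2] at h3
      cases h3
      exact h2
    · intro a ha' b hb' hab
      simp only [Finset.coe_filter, Finset.mem_range, Set.mem_setOf_eq] at ha' hb'
      exact hc' _ _ _ (hf2 a ha') (hab ▸ hf2 b hb')
  let reg : ℕ → Regs := fun t => Nat.rec (fun _ => 0) (fun k σ => opApply (op k) σ) t
  have hr : ∀ t, reg (t + 1) = opApply (op t) (reg t) := fun t => rfl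
  have inv : ∀ t i, reg t i + cnt op (.dec i) t = cnt op (.inc i) t := by
    intro t
    induction t with
    | zero => intro i; simp [cnt, reg]
    | succ t ih =>
      intro i
      have hi := ih i
      rw [hr, cnt_succ, cnt_succ]
      cases ho : op t with
      | inc j =>
        by_cases hij : i = j
        · subst hij; simp [opApply]; omega
        · simp [opApply, Function.update_of_ne hij, Ne.symm hij]; omega
      | dec j =>
        by_cases hij : i = j
        · subst hij
          have := h1 t i ho
          rw [cnt_succ, if_pos ho] at this
          simp [opApply]; omega
        · simp [opApply, Function.update_of_ne hij, Ne.symm hij]; omega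
      | _ => simp [opApply]; omega
  refine ⟨reg, rfl, fun t => ?_⟩
  rw [hr]
  cases ho : op t with
  | inc j => simp [opApply, opRel]
  | dec j =>
    have := h1 t j ho
    rw [cnt_succ, if_pos ho] at this
    have := inv t j
    simp [opApply, opRel]; omega
  | zero j =>
    have := h2 t j ho
    have := inv t j
    simp [opApply, opRel]; omega
  | nop => simp [opApply, opRel]

end Counters

/-! ## Soundness: a frame satisfying the formula yields a run -/

section Sound
variable {W : Type} {R0 R1 : W → W → Prop}

/-- `u`'s class sees `u'`. -/
def UR (R0 R1 : W → W → Prop) (u u' : W) : Prop := ∃ x, EqR R1 u x ∧ R0 x u'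

namespace FrameProps
variable (F : FrameProps R0 R1)
include F

theorem eS {x y : W} (h : EqR R1 x y) : EqR R1 y x := by
  rcases h with rfl | h
  · exact Or.inl rfl
  · exact Or.inr (F.sym _ _ h)

theorem eT {x y z : W} (h : EqR R1 x y) (h' : EqR R1 y z) : EqR R1 x z := by
  rcases h with rfl | h
  · exact h'
  · rcases h' with rfl | h'
    · exact Or.inr h
    · exact F.pt _ _ _ h h'

theorem lcE {x y z : W} (h : R0 x y) (h' : EqR R1 y z) : ∃ u, EqR R1 x u ∧ R0 u z := by
  rcases h' with rfl | h'
  · exact ⟨x, Or.inl rfl, h⟩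
  · obtain ⟨u, a, b⟩ := F.lcom _ _ _ h h'
    exact ⟨u, Or.inr a, b⟩

theorem rcE {x y z : W} (h : EqR R1 x y) (h' : R0 y z) : ∃ u, R0 x u ∧ EqR R1 u z := by
  rcases h with rfl | h
  · exact ⟨z, h', Or.inl rfl⟩
  · obtain ⟨u, a, b⟩ := F.rcom _ _ _ h h'
    exact ⟨u, a, Or.inr b⟩

theorem uL {a a' b : W} (h : EqR R1 a a') (h' : UR R0 R1 a' b) : UR R0 R1 a b := by
  obtain ⟨x, h1, h2⟩ := h'
  exact ⟨x, F.eT h h1, h2⟩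

theorem uR {a b b' : W} (h : UR R0 R1 a b) (h' : EqR R1 b b') : UR R0 R1 a b' := by
  obtain ⟨x, h1, h2⟩ := h
  obtain ⟨u, h3, h4⟩ := F.lcE h2 h'
  exact ⟨u, F.eT h1 h3, h4⟩

omit F in
theorem uOf {a b : W} (h : R0 a b) : UR R0 R1 a b := ⟨a, Or.inl rfl, h⟩

theorem uT {a b c : W} (h : UR R0 R1 a b) (h' : UR R0 R1 b c) : UR R0 R1 a c := by
  obtain ⟨y, h3, h4⟩ := h'
  obtain ⟨x, h1, h2⟩ := F.uR h h3
  exact ⟨x, h1, F.trans _ _ _ h2 h4⟩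

/-- From any member of the class one reaches the class of `b`. -/
theorem uD {a b : W} (h : UR R0 R1 a b) : ∃ u, R0 a u ∧ EqR R1 b u := by
  obtain ⟨x, h1, h2⟩ := h
  obtain ⟨u, h3, h4⟩ := F.rcE h1 h2
  exact ⟨u, h3, F.eS h4⟩

end FrameProps

variable {N D Pr : W → Prop} {Lab : W → Instr → Prop} {e n : ℕ} {r : W}

structure Ctx (R0 R1 : W → W → Prop) (N D Pr : W → Prop) (Lab : W → Instr → Prop) (e n : ℕ) (r : W) : Prop where
  F : FrameProps R0 R1
  S : Sem R0 R1 N D Pr Lab e n r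
  uniq : ∀ w x y, Lab w x → Lab w y → x = y

namespace Ctx
variable (C : Ctx R0 R1 N D Pr Lab e n r)
include C

theorem qU {w v : W} (h : Below R0 R1 r w) (h' : UR R0 R1 w v) : Below R0 R1 r v := C.F.uT h h'
theorem qE {w v : W} (h : Below R0 R1 r w) (h' : EqR R1 w v) : Below R0 R1 r v := C.F.uR h h'
theorem qR {w v : W} (h : Below R0 R1 r w) (h' : R0 w v) : Below R0 R1 r v := C.qU h (FrameProps.uOf h')

theorem eqN {w v : W} (hq : Below R0 R1 r w) (hw : N w) (hv : N v) (h : EqR R1 w v) : w = v := by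
  rcases h with h | h
  · exact h
  · exact absurd hv ((C.S.s1 _ hq hw).1 _ h)

theorem rowN {x w v : W} (hq : Below R0 R1 r x ∨ EqR R1 r x) (hw : N w) (hv : N v) (h : R0 x w) (h' : R0 x v) : w = v := by
  have hq' : ∀ y, R0 x y → Below R0 R1 r y := by
    intro y hy
    rcases hq with hq | hq
    · exact C.qR hq hy
    · exact ⟨x, hq, hy⟩
  rcases C.F.conn _ _ _ h h' with h1 | h1 | h1
  · exact h1
  · exact absurd hv ((C.S.s1 _ (hq' _ h) hw).2 _ h1)
  · exact absurd hw ((C.S.s1 _ (hq' _ h') hv).2 _ h1)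

theorem endP {c : W} (hq : Below R0 R1 r c) (hc : N c) :
    ∃ y, R0 c y ∧ (∀ u, N u → ¬ EqR R1 y u) ∧ ∀ u, N u → ¬ UR R0 R1 y u := by
  obtain ⟨y, h1, h2⟩ := C.S.s6 c hq hc
  refine ⟨y, h1, fun u hu h => (h2 u h).1 hu, ?_⟩
  rintro u hu ⟨x, h3, h4⟩
  exact (h2 x h3).2 u h4 hu

theorem irr {c : W} (hq : Below R0 R1 r c) (hc : N c) : ¬ UR R0 R1 c c := by
  intro hcc
  obtain ⟨x, -, h, -⟩ := C.S.s3 c hq hc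
  rcases h with ⟨-, h⟩ | ⟨y, hy, ⟨z, hyz, hz, hpar, -⟩, hnn⟩
  · obtain ⟨y, h1, h2⟩ := hcc
    exact h y h1 c h2 hc
  · have hyc : UR R0 R1 y c := C.F.uL (C.F.eS (Or.inr hy)) hcc
    have hcz : UR R0 R1 c z := ⟨y, Or.inr hy, hyz⟩
    have hne : ¬ EqR R1 c z := by
      intro h
      have := C.eqN hq hc hz h
      subst this
      tauto
    obtain ⟨c', h1, h2⟩ := C.F.uD hyc
    have hzc : UR R0 R1 z c := by
      rcases C.F.conn _ _ _ hyz h1 with h3 | h3 | h3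
      · subst h3; exact absurd h2 hne
      · exact C.F.uR (FrameProps.uOf h3) (C.F.eS h2)
      · exact absurd hz (hnn _ h1 _ h3)
    obtain ⟨y', h3, h4, h5⟩ := C.endP hq hc
    have := C.F.disc (fun v => EqR R1 c v) c y' (Or.inl rfl) ?_ h3 (fun h => h4 c hc (C.F.eS h))
    · obtain ⟨u, h6, h7⟩ := this
      exact h5 c hc (C.F.uR (FrameProps.uOf h6) (C.F.eS h7))
    · intro v _ hv
      obtain ⟨u, h6, h7⟩ := C.F.uD (C.F.uL (C.F.eS hv) hcz)
      refine ⟨u, h6, fun h => hne (C.F.eT h (C.F.eS h7)), ?_⟩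
      obtain ⟨u', h8, h9⟩ := C.F.uD (C.F.uL (C.F.eS h7) hzc)
      exact ⟨u', h8, h9⟩

theorem tot {a b : W} (qa : Below R0 R1 r a) (ha : N a) (qb : Below R0 R1 r b) (hb : N b) :
    a = b ∨ UR R0 R1 a b ∨ UR R0 R1 b a := by
  obtain ⟨a', h1, h2⟩ := C.F.uD qa
  obtain ⟨b', h3, h4⟩ := C.F.uD qb
  rcases C.F.conn _ _ _ h1 h3 with h | h | h
  · subst h
    exact Or.inl (C.eqN qa ha hb (C.F.eT h2 (C.F.eS h4)))
  · exact Or.inr (Or.inl (C.F.uR ⟨a', h2, h⟩ (C.F.eS h4)))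
  · exact Or.inr (Or.inr (C.F.uR ⟨b', h4, h⟩ (C.F.eS h2)))

theorem asymm {a b : W} (qa : Below R0 R1 r a) (ha : N a) (h : UR R0 R1 a b) (h' : UR R0 R1 b a) : False :=
  C.irr qa ha (C.F.uT h h')

theorem wf : WellFounded fun a b : {w // Below R0 R1 r w ∧ N w} => UR R0 R1 b.1 a.1 := by
  rw [wellFounded_iff_isEmpty_descending_chain]
  refine ⟨?_⟩
  rintro ⟨a, ha⟩
  have hch : ∀ i k, UR R0 R1 (a i).1 (a (i + k + 1)).1 := by
    intro i k
    induction k with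
    | zero => exact ha i
    | succ k ih => exact C.F.uT ih (ha _)
  have hinj : ∀ i j, EqR R1 (a i).1 (a j).1 → i = j := by
    intro i j h
    rcases lt_trichotomy i j with h1 | h1 | h1
    · have := hch i (j - i - 1)
      rw [show i + (j - i - 1) + 1 = j by omega] at this
      exact absurd (C.F.uR this (C.F.eS h)) (C.irr (a i).2.1 (a i).2.2)
    · exact h1
    · have := hch j (i - j - 1)
      rw [show j + (i - j - 1) + 1 = i by omega] at this
      exact absurd (C.F.uR this h) (C.irr (a j).2.1 (a j).2.2)
  obtain ⟨y, h3, h4, h5⟩ := C.endP (a 0).2.1 (a 0).2.2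
  have := C.F.disc (fun v => ∃ i, EqR R1 (a (2 * i)).1 v) (a 0).1 y ⟨0, Or.inl rfl⟩ ?_ h3 ?_
  · obtain ⟨u, h6, i, h7⟩ := this
    exact h5 _ (a (2 * i)).2.2 (C.F.uR (FrameProps.uOf h6) (C.F.eS h7))
  · rintro v - ⟨i, hi⟩
    obtain ⟨u, h6, h7⟩ := C.F.uD (C.F.uL (C.F.eS hi) (ha (2 * i)))
    refine ⟨u, h6, ?_, ?_⟩
    · rintro ⟨j, hj⟩
      have := hinj _ _ (C.F.eT hj (C.F.eS h7))
      omega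
    · obtain ⟨u', h8, h9⟩ := C.F.uD (C.F.uL (C.F.eS h7) (ha (2 * i + 1)))
      exact ⟨u', h8, i + 1, h9⟩
  · rintro ⟨i, hi⟩
    exact h4 _ (a (2 * i)).2.2 (C.F.eS hi)

/-- immediate predecessors -/
theorem pred {a y z b : W} (qa : Below R0 R1 r a) (hy : R1 a y) (hyz : R0 y z) (hz : N z)
    (hnn : ∀ z, R0 y z → ∀ z', R0 z z' → ¬ N z') (hb : N b) (h1 : UR R0 R1 a b) (h2 : UR R0 R1 b z) : False := by
  have qb := C.qU qa h1
  obtain ⟨b', h3, h4⟩ := C.F.uD (C.F.uL (C.F.eS (Or.inr hy)) h1)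
  rcases C.F.conn _ _ _ h3 hyz with h | h | h
  · subst h
    have := C.eqN qb hb hz h4
    subst this
    exact C.irr qb hb h2
  · exact hnn _ h3 _ h hz
  · exact C.asymm qb hb h2 (C.F.uR (FrameProps.uOf h) (C.F.eS h4))

theorem above {a : W} (qa : Below R0 R1 r a) (ha : N a) :
    ∃ v, Below R0 R1 r v ∧ N v ∧ UR R0 R1 v a ∧ ∃ x, Lab v x ∧ x.1 = e := by
  obtain ⟨ρ, h1, h2⟩ := qa
  obtain ⟨y, h3, ⟨z, h4, h5⟩, v, h6, h7, h8⟩ := C.S.s5 ρ h1 ⟨a, h2, ha⟩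
  have := C.rowN (Or.inr h1) ha h5 h2 (C.F.trans _ _ _ h3 h4)
  subst this
  have qy : Below R0 R1 r y := ⟨ρ, h1, h3⟩
  exact ⟨v, C.qE qy (Or.inr h6), h7, C.F.uL (C.F.eS (Or.inr h6)) (FrameProps.uOf h4), h8⟩

theorem inj {a a' w : W} (qa : Below R0 R1 r a) (hw : N w) (h : R0 a w) (h' : R0 a' w) (he : EqR R1 a a') : a = a' := by
  rcases he with he | he
  · exact he
  have qw := C.qR qa h
  obtain ⟨u, h1, h2⟩ := C.F.conf _ _ _ h he
  exfalso
  rcases C.F.conn _ _ _ h' h2 with h3 | h3 | h3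
  · subst h3; exact (C.S.s1 _ qw hw).1 _ h1 hw
  · exact C.irr qw hw (C.F.uR (FrameProps.uOf h3) (C.F.eS (Or.inr h1)))
  · exact C.irr qw hw ⟨u, Or.inr h1, h3⟩

/-- Enumeration of the time points. -/
theorem enum : ∃ u : ℕ → W, (∀ k, Below R0 R1 r (u k) ∧ N (u k)) ∧
    (∀ w, Below R0 R1 r w → N w → ∃ k, u k = w) ∧
    (∀ k m, UR R0 R1 (u k) (u m) ↔ m < k) ∧
    (∀ x, Lab (u 0) x → x.1 = 0) ∧
    (∀ k x x', Lab (u k) x → Lab (u (k + 1)) x' → x'.1 = x.2.2) := by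
  let T := {w // Below R0 R1 r w ∧ N w}
  have hmin : ∀ P : T → Prop, (∃ a, P a) → ∃ a, P a ∧ ∀ b, P b → ¬ UR R0 R1 a.1 b.1 := by
    intro P hP
    exact ⟨C.wf.min {a | P a} hP, C.wf.min_mem {a | P a} hP, fun b hb => C.wf.not_lt_min {a | P a} hb⟩
  obtain ⟨w0, q0, n0⟩ := C.S.s2
  obtain ⟨u0, -, hu0⟩ := hmin (fun _ => True) ⟨⟨w0, q0, n0⟩, trivial⟩
  have hs : ∀ a : T, ∃ b : T, UR R0 R1 b.1 a.1 ∧ ∀ c : T, UR R0 R1 c.1 a.1 → ¬ UR R0 R1 b.1 c.1 := by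
    intro a
    obtain ⟨v, h1, h2, h3, -⟩ := C.above a.2.1 a.2.2
    exact hmin (fun b => UR R0 R1 b.1 a.1) ⟨⟨v, h1, h2⟩, h3⟩
  choose sc hsc1 hsc2 using hs
  let u : ℕ → T := fun k => sc^[k] u0
  have us : ∀ k, u (k + 1) = sc (u k) := fun k => Function.iterate_succ_apply' sc k u0
  have hlt : ∀ i k, UR R0 R1 (u (i + k + 1)).1 (u i).1 := by
    intro i k
    induction k with
    | zero => rw [add_zero, us]; exact hsc1 _
    | succ k ih => rw [us]; exact C.F.uT (hsc1 _) ih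
  have hlt' : ∀ i j, i < j → UR R0 R1 (u j).1 (u i).1 := by
    intro i j h
    have := hlt i (j - i - 1)
    rwa [show i + (j - i - 1) + 1 = j by omega] at this
  have pre : ∀ k (a : T), UR R0 R1 a.1 (u k).1 → (∀ b : T, UR R0 R1 a.1 b.1 → ¬ UR R0 R1 b.1 (u k).1) → a = u (k + 1) := by
    intro k a h1 h2
    rcases C.tot a.2.1 a.2.2 (u (k + 1)).2.1 (u (k + 1)).2.2 with h | h | h
    · exact Subtype.ext h
    · exact absurd (hlt' k (k + 1) (by omega)) (h2 _ h)
    · rw [us] at h; exact absurd h (hsc2 _ a h1)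
  refine ⟨fun k => (u k).1, fun k => (u k).2, ?_, ?_, ?_, ?_⟩
  · intro w qw hw
    have : ∀ a : T, ∃ k, u k = a := by
      intro a
      induction a using C.wf.induction with
      | _ a ih =>
        obtain ⟨x, -, h, -⟩ := C.S.s3 a.1 a.2.1 a.2.2
        rcases h with ⟨-, h⟩ | ⟨y, hy, ⟨z, hyz, hz, hpar, -⟩, hnn⟩
        · refine ⟨0, ?_⟩
          rcases C.tot a.2.1 a.2.2 u0.2.1 u0.2.2 with h1 | ⟨y, h1, h2⟩ | h1
          · exact (Subtype.ext h1).symm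
          · exact absurd u0.2.2 (h y h1 _ h2)
          · exact absurd h1 (hu0 a trivial)
        · have haz : UR R0 R1 a.1 z := ⟨y, Or.inr hy, hyz⟩
          obtain ⟨k, hk⟩ := ih ⟨z, C.qU a.2.1 haz, hz⟩ haz
          refine ⟨k + 1, (pre k a (by rw [hk]; exact haz) ?_).symm⟩
          intro b h1 h2
          rw [hk] at h2
          exact C.pred a.2.1 hy hyz hz hnn b.2.2 h1 h2
    obtain ⟨k, hk⟩ := this ⟨w, qw, hw⟩
    exact ⟨k, congrArg Subtype.val hk⟩
  · intro k m
    refine ⟨fun h => ?_, hlt' m k⟩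
    by_contra hcon
    rcases Nat.lt_or_ge k m with h1 | h1
    · exact C.asymm (u k).2.1 (u k).2.2 h (hlt' _ _ h1)
    · have : k = m := by omega
      subst this
      exact C.irr (u k).2.1 (u k).2.2 h
  · intro x hx
    obtain ⟨x', hx', h, -⟩ := C.S.s3 (u 0).1 (u 0).2.1 (u 0).2.2
    have := C.uniq _ _ _ hx hx'
    subst this
    rcases h with ⟨h, -⟩ | ⟨y, hy, ⟨z, hyz, hz, hpar, -⟩, hnn⟩
    · exact h
    · have haz : UR R0 R1 (u 0).1 z := ⟨y, Or.inr hy, hyz⟩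
      exact absurd haz (hu0 ⟨z, C.qU (u 0).2.1 haz, hz⟩ trivial)
  · intro k x x' hx hx'
    obtain ⟨x'', hx'', h, -⟩ := C.S.s3 (u (k + 1)).1 (u (k + 1)).2.1 (u (k + 1)).2.2
    have := C.uniq _ _ _ hx' hx''
    subst this
    have hk := hlt' k (k + 1) (by omega)
    rcases h with ⟨-, h⟩ | ⟨y, hy, ⟨z, hyz, hz, hpar, y', hy', hyy⟩, hnn⟩
    · obtain ⟨y, h1, h2⟩ := hk
      exact absurd (u k).2.2 (h y h1 _ h2)
    · have haz : UR R0 R1 (u (k + 1)).1 z := ⟨y, Or.inr hy, hyz⟩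
      have qz := C.qU (u (k + 1)).2.1 haz
      have : (u k).1 = z := by
        rcases C.tot (u k).2.1 (u k).2.2 qz hz with h | h | h
        · exact h
        · exact (C.pred (u (k + 1)).2.1 hy hyz hz hnn (u k).2.2 hk h).elim
        · rw [us] at haz
          exact absurd haz (hsc2 _ ⟨z, qz, hz⟩ h)
      subst this
      rw [C.uniq _ _ _ hx hy', hyy]

theorem sound {M : List Instr} (hM : ∀ w x, Lab w x → x ∈ M) : GoodRun M e n := by
  obtain ⟨u, hu, hall, hU, h0, hsucc⟩ := C.enum
  have hl : ∀ t, ∃ x, Lab (u t) x ∧ opS R0 R1 N D Lab (u t) x.2.1 := by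
    intro t
    obtain ⟨x, h1, -, h2⟩ := C.S.s3 _ (hu t).1 (hu t).2
    exact ⟨x, h1, h2⟩
  choose lab hlab hop using hl
  have hlu : ∀ t x, Lab (u t) x → x = lab t := fun t x h => C.uniq _ _ _ h (hlab t)
  have uinj : ∀ s t, EqR R1 (u s) (u t) → s = t := by
    intro s t h
    have := C.eqN (hu s).1 (hu s).2 (hu t).2 h
    by_contra hne
    rcases Nat.lt_or_gt_of_ne hne with h1 | h1
    · have h2 := (hU _ _).2 h1
      rw [← this] at h2
      exact C.irr (hu s).1 (hu s).2 h2
    · have h2 := (hU _ _).2 h1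
      rw [← this] at h2
      exact C.irr (hu s).1 (hu s).2 h2
  let Dm : ℕ → ℕ → Prop := fun t s => ∃ z, EqR R1 (u t) z ∧ D z ∧ R0 z (u s)
  have d4 : ∀ z, Below R0 R1 r z → D z → ∃ t s i, EqR R1 (u t) z ∧ R0 z (u s) ∧
      (lab t).2.1 = .dec i ∧ (lab s).2.1 = .inc i := by
    intro z qz hz
    obtain ⟨-, -, i, ⟨v, h1, h2, x, h3, h4⟩, z', h5, h6, x', h7, h8⟩ := C.S.s4 z qz hz
    obtain ⟨t, rfl⟩ := hall v (C.qE qz (Or.inr h1)) h2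
    obtain ⟨s, rfl⟩ := hall z' (C.qR qz h5) h6
    refine ⟨t, s, i, C.F.eS (Or.inr h1), h5, ?_, ?_⟩
    · rw [← hlu _ _ h3, h4]
    · rw [← hlu _ _ h7, h8]
  have row : ∀ z s s', Below R0 R1 r z → R0 z (u s) → R0 z (u s') → s = s' := by
    intro z s s' qz h h'
    exact uinj _ _ (Or.inl (C.rowN (Or.inl qz) (hu s).2 (hu s').2 h h'))
  have hcnt := counters (fun t => (lab t).2.1) Dm ?_ ?_ ?_ ?_ ?_
  · obtain ⟨reg, hr0, hr⟩ := hcnt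
    refine ⟨lab, reg, fun t => hM _ _ (hlab t), h0 _ (hlab 0), fun t => hsucc t _ _ (hlab t) (hlab (t + 1)),
      hr0, hr, ?_, ?_⟩
    · intro t
      obtain ⟨v, h1, h2, h3, x, h4, h5⟩ := C.above (hu t).1 (hu t).2
      obtain ⟨t', rfl⟩ := hall v h1 h2
      refine ⟨t', (hU _ _).1 h3, ?_⟩
      rw [← hlu _ _ h4, h5]
    · intro t ht
      have hs : ∀ k t w, EqR R1 (u t) w → (HsS R0 R1 N k w ↔ k ≤ t) := by
        intro k
        induction k with
        | zero => intro t w _; simp [HsS]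
        | succ k ih =>
          intro t w hw
          constructor
          · rintro ⟨v, h1, ⟨x, h2, h3⟩, h4⟩
            have h5 : UR R0 R1 (u t) x := C.F.uR ⟨w, hw, h1⟩ h2
            obtain ⟨s, rfl⟩ := hall x (C.qU (hu t).1 h5) h3
            have := (hU _ _).1 h5
            have := (ih s v (C.F.eS h2)).1 h4
            omega
          · intro hk
            have h1 := (hU t (t - 1)).2 (by omega)
            obtain ⟨v, h2, h3⟩ := C.F.uD (C.F.uL (C.F.eS hw) h1)
            exact ⟨v, h2, ⟨_, C.F.eS h3, (hu _).2⟩, (ih _ v h3).2 (by omega)⟩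
      have h7 := C.S.s7 _ (hu t).1 (hu t).2 (ht ▸ hlab t)
      rw [hs _ t _ (Or.inl rfl), hs _ t _ (Or.inl rfl)] at h7
      omega
  · intro t i hi
    have := hop t
    rw [hi] at this
    obtain ⟨v, h1, h2⟩ := this
    obtain ⟨t', s, -, h3, h4, -⟩ := d4 v (C.qE (hu t).1 (Or.inr h1)) h2
    exact ⟨s, v, Or.inr h1, h2, h4⟩
  · rintro t s ⟨z, h1, h2, h3⟩
    have qz := C.qE (hu t).1 h1
    obtain ⟨t', s', i, h4, h5, h6, h7⟩ := d4 z qz h2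
    have e1 := uinj _ _ (C.F.eT h1 (C.F.eS h4))
    have e2 := row z _ _ qz h3 h5
    subst e1 e2
    exact ⟨(hU _ _).1 ⟨z, h1, h3⟩, i, h6, h7⟩
  · have key : ∀ t t' s, Dm t s → Dm t' s → ¬ t' < t := by
      rintro t t' s ⟨z, h1, h2, h3⟩ ⟨z', h4, h5, h6⟩ hlt
      have h7 := C.F.uR (C.F.uL (C.F.eS h1) ((hU _ _).2 hlt)) h4
      obtain ⟨x, h8, h9⟩ := h7
      have qz := C.qE (hu t).1 h1
      have := C.inj qz (hu s).2 h3 (C.F.trans _ _ _ h9 h6) h8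
      subst this
      exact (C.S.s4 _ qz h2).2.1 _ h9 h5
    intro t t' s h h'
    have := key _ _ _ h h'
    have := key _ _ _ h' h
    omega
  · rintro t s s' ⟨z, h1, h2, h3⟩ ⟨z', h4, h5, h6⟩
    have qz := C.qE (hu t).1 h1
    rcases C.F.eT (C.F.eS h1) h4 with h | h
    · subst h
      exact row z _ _ qz h3 h6
    · exact absurd h5 ((C.S.s4 _ qz h2).1 _ h)
  · intro t i s hi hst hs
    have ho := hop t
    rw [hi] at ho
    obtain ⟨x, h1, h2⟩ := (hU _ _).2 hst
    have h1' : R1 (u t) x := by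
      rcases h1 with rfl | h1
      · exact absurd (hu s).2 ((C.S.s1 _ (hu t).1 (hu t).2).2 _ h2)
      · exact h1
    obtain ⟨z, h3, h4⟩ := ho x h1' ⟨u s, h2, (hu s).2, lab s, hlab s, hs⟩
    have qz := C.qR (C.qE (hu t).1 h1) h3
    obtain ⟨t', s', -, h5, h6, -⟩ := d4 z qz h4
    refine ⟨t', (hU _ _).1 (C.F.uR ⟨x, h1, h3⟩ (C.F.eS h5)), z, h5, h4, ?_⟩
    rcases C.F.conn _ _ _ h3 h2 with h | h | h
    · subst h
      exact absurd (hu s').2 ((C.S.s1 _ (hu s).1 (hu s).2).2 _ h6)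
    · exact h
    · exact absurd (hu s').2 ((C.S.s1 _ (hu s).1 (hu s).2).2 _ (C.F.trans _ _ _ h h6))

end Ctx
end Sound

/-! ## Completeness: a run yields a product model -/

section Matching
open Classical

theorem cnt_mono (op : ℕ → Op) (o : Op) {s t : ℕ} (h : s ≤ t) : cnt op o s ≤ cnt op o t := by
  induction h with
  | refl => exact le_rfl
  | step _ ih => rw [Nat.succ_eq_add_one, cnt_succ]; omega

theorem cnt_inj (op : ℕ → Op) (o : Op) {s t : ℕ} (hs : op s = o) (ht : op t = o) (h : cnt op o s = cnt op o t) : s = t := by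
  rcases lt_trichotomy s t with h1 | h1 | h1
  · have := cnt_mono op o (show s + 1 ≤ t from h1)
    rw [cnt_succ, if_pos hs] at this
    omega
  · exact h1
  · have := cnt_mono op o (show t + 1 ≤ s from h1)
    rw [cnt_succ, if_pos ht] at this
    omega

theorem cnt_ex (op : ℕ → Op) (o : Op) {k t : ℕ} (h : k < cnt op o t) : ∃ m, m < t ∧ op m = o ∧ cnt op o m = k := by
  induction t with
  | zero => simp [cnt] at h
  | succ t ih =>
    by_cases h1 : k < cnt op o t
    · obtain ⟨m, h2, h3⟩ := ih h1
      exact ⟨m, by omega, h3⟩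
    · rw [cnt_succ] at h
      split_ifs at h with h2
      · exact ⟨t, by omega, h2, by omega⟩
      · omega

theorem matching (op : ℕ → Op) (reg : ℕ → Regs) (h0 : reg 0 = fun _ => 0)
    (hr : ∀ t, opRel (op t) (reg t) (reg (t + 1))) :
    ∃ μ : ℕ → ℕ, (∀ t i, op t = .dec i → μ t < t ∧ op (μ t) = .inc i) ∧
      (∀ t t' i, op t = .dec i → op t' = .dec i → μ t = μ t' → t = t') ∧
      (∀ t i s, op t = .zero i → s < t → op s = .inc i → ∃ t', t' < t ∧ op t' = .dec i ∧ μ t' = s) := by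
  have inv : ∀ t i, reg t i + cnt op (.dec i) t = cnt op (.inc i) t := by
    intro t
    induction t with
    | zero => intro i; simp [cnt, h0]
    | succ t ih =>
      intro i
      have hi := ih i
      have h := hr t
      rw [cnt_succ, cnt_succ]
      cases ho : op t with
      | inc j =>
        rw [ho] at h
        simp only [opRel] at h
        rw [h]
        by_cases hij : i = j
        · subst hij; simp; omega
        · simp [Function.update_of_ne hij, Ne.symm hij]; omega
      | dec j =>
        rw [ho] at h
        simp only [opRel] at h
        rw [h.2]
        by_cases hij : i = j
        · subst hij; simp; omega
        · simp [Function.update_of_ne hij, Ne.symm hij]; omega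
      | zero j => rw [ho] at h; simp only [opRel] at h; rw [h.2]; simp; omega
      | nop => rw [ho] at h; simp only [opRel] at h; rw [h]; simp; omega
  have hmu : ∀ t, ∃ m, ∀ i, op t = .dec i → m < t ∧ op m = .inc i ∧ cnt op (.inc i) m = cnt op (.dec i) t := by
    intro t
    by_cases hd : ∃ i, op t = .dec i
    · obtain ⟨i, hi⟩ := hd
      have h := hr t
      rw [hi] at h
      have hpos : 0 < reg t i := h.1
      have := inv t i
      obtain ⟨m, h1, h2, h3⟩ := cnt_ex op (.inc i) (k := cnt op (.dec i) t) (t := t) (by omega)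
      refine ⟨m, fun j hj => ?_⟩
      rw [hi] at hj
      cases hj
      exact ⟨h1, h2, h3⟩
    · exact ⟨0, fun i hi => absurd ⟨i, hi⟩ hd⟩
  choose μ hμ using hmu
  refine ⟨μ, fun t i h => ⟨(hμ t i h).1, (hμ t i h).2.1⟩, ?_, ?_⟩
  · intro t t' i h h' he
    refine cnt_inj op _ h h' ?_
    rw [← (hμ t i h).2.2, ← (hμ t' i h').2.2, he]
  · intro t i s hz hst hs
    have h := hr t
    rw [hz] at h
    have hpos : reg t i = 0 := h.1
    have := inv t i
    have h2 := cnt_mono op (.inc i) (show s + 1 ≤ t from hst)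
    rw [cnt_succ, if_pos hs] at h2
    obtain ⟨m, h3, h4, h5⟩ := cnt_ex op (.dec i) (k := cnt op (.inc i) s) (t := t) (by omega)
    refine ⟨m, h3, h4, cnt_inj op (.inc i) (hμ m i h4).2.1 hs ?_⟩
    rw [(hμ m i h4).2.2, h5]

end Matching

/-- The horizontal frame `ω+1` read downwards, with the last point reflexive iff `s`. -/
def AR (s : Prop) (a b : ℕ∞) : Prop := b < a ∨ (s ∧ a = 0 ∧ b = 0)

theorem eqR_prod {s : ℕ∞ × ℕ} {w : ℕ∞ × ℕ} :
    EqR (prodR1 (fun a b : ℕ => a ≠ b)) s w ↔ s.1 = w.1 := by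
  simp only [EqR, prodR1]
  constructor
  · rintro (rfl | h)
    · rfl
    · exact h.1
  · intro h
    by_cases h2 : s.2 = w.2
    · exact Or.inl (Prod.ext h h2)
    · exact Or.inr ⟨h, h2⟩

theorem AR_pos {s : Prop} {t : ℕ} {b : ℕ∞} (h : AR s ((t + 1 : ℕ) : ℕ∞) b) : b < ((t + 1 : ℕ) : ℕ∞) := by
  rcases h with h | ⟨-, h, -⟩
  · exact h
  · exact absurd h (by simp)

/-- The valuation of the intended model. -/
def mval (op : ℕ → Op) (μ idx : ℕ → ℕ) : ℕ → ℕ∞ × ℕ → Prop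
  | 0, w => w.1 = ((w.2 + 1 : ℕ) : ℕ∞)
  | 1, w => ∃ t i, w.1 = ((t + 1 : ℕ) : ℕ∞) ∧ op t = .dec i ∧ w.2 = μ t
  | 2, w => ∃ t, w.1 = ((t + 1 : ℕ) : ℕ∞) ∧ Even t
  | j + 3, w => ∃ t, w.1 = ((t + 1 : ℕ) : ℕ∞) ∧ idx t = j

theorem complete (s : Prop) {M : List Instr} {e n : ℕ} (h : GoodRun M e n) :
    ∃ val w, BSat (prodR0 (AR s)) (prodR1 (fun a b : ℕ => a ≠ b)) val w (mainF M e n) := by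
  obtain ⟨lab, reg, hM, hz, hs, hr0, hr, hinf, hn⟩ := h
  have hidx : ∀ t, ∃ j, j < M.length ∧ insAt M j = lab t := by
    intro t
    obtain ⟨j, hj, h⟩ := List.mem_iff_getElem.1 (hM t)
    exact ⟨j, hj, by simp [insAt, List.getD, hj, h]⟩
  choose idx hidx1 hidx2 using hidx
  obtain ⟨μ, hμ1, hμ2, hμ3⟩ := matching (fun t => (lab t).2.1) reg hr0 hr
  have cinj : ∀ {a b : ℕ}, ((a + 1 : ℕ) : ℕ∞) = ((b + 1 : ℕ) : ℕ∞) → a = b := by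
    intro a b h; have := ENat.coe_inj.1 h; omega
  have h0ne : ∀ k : ℕ, (0 : ℕ∞) ≠ ((k + 1 : ℕ) : ℕ∞) := by
    intro k h
    have : (0 : ℕ) = k + 1 := ENat.coe_inj.1 (by rw [← h]; rfl)
    omega
  have clt : ∀ {a b : ℕ}, ((a + 1 : ℕ) : ℕ∞) < ((b + 1 : ℕ) : ℕ∞) ↔ a < b := by
    intro a b; rw [ENat.coe_lt_coe]; omega
  refine ⟨mval (fun t => (lab t).2.1) μ idx, (⊤, 0), ?_⟩
  rw [sat_mainF]
  set val := mval (fun t => (lab t).2.1) μ idx with hval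
  have vN : ∀ w, val 0 w ↔ w.1 = ((w.2 + 1 : ℕ) : ℕ∞) := fun w => Iff.rfl
  have vD : ∀ w, val 1 w ↔ ∃ t i, w.1 = ((t + 1 : ℕ) : ℕ∞) ∧ (lab t).2.1 = .dec i ∧ w.2 = μ t := fun w => Iff.rfl
  have vP : ∀ t x, val 2 (((t + 1 : ℕ) : ℕ∞), x) ↔ Even t := by
    intro t x
    constructor
    · rintro ⟨t', h1, h2⟩
      rw [cinj h1]; exact h2
    · intro h; exact ⟨t, rfl, h⟩
  have vj : ∀ j t x, val (3 + j) (((t + 1 : ℕ) : ℕ∞), x) ↔ idx t = j := by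
    intro j t x
    rw [add_comm]
    constructor
    · rintro ⟨t', h1, h2⟩
      rw [cinj h1]; exact h2
    · intro h; exact ⟨t, rfl, h⟩
  have vL : ∀ t x, LabS M val (((t + 1 : ℕ) : ℕ∞), x) (lab t) := by
    intro t x
    refine ⟨idx t, hidx1 t, ⟨(vj _ _ _).2 rfl, fun i hi => ?_⟩, hidx2 t⟩
    rw [vj]; omega
  have vLu : ∀ t x y, LabS M val (((t + 1 : ℕ) : ℕ∞), x) y → y = lab t := fun t x y h => h.uniq (vL t x)
  have vN' : ∀ t, val 0 (((t + 1 : ℕ) : ℕ∞), t) := fun t => rfl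
  have cN : ∀ w, val 0 w → w = (((w.2 + 1 : ℕ) : ℕ∞), w.2) := fun w h => Prod.ext h rfl
  have r0 : ∀ {a b : ℕ} {x : ℕ}, a < b → prodR0 (AR s) (((b + 1 : ℕ) : ℕ∞), x) (((a + 1 : ℕ) : ℕ∞), x) := by
    intro a b x h
    exact ⟨Or.inl (clt.2 h), rfl⟩
  have r0top : ∀ {a : ℕ} {x : ℕ}, prodR0 (AR s) ((⊤ : ℕ∞), x) ((a : ℕ∞), x) := by
    intro a x
    exact ⟨Or.inl (ENat.coe_lt_top a), rfl⟩
  refine ⟨?_, ?_, ?_, ?_, ?_, ?_, ?_⟩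
  · intro w _ hw
    obtain ⟨a, t⟩ := w
    obtain rfl : a = ((t + 1 : ℕ) : ℕ∞) := hw
    constructor
    · rintro ⟨b, x⟩ ⟨h1, h2⟩ hv
      obtain rfl : b = ((x + 1 : ℕ) : ℕ∞) := hv
      exact h2 (cinj h1)
    · rintro ⟨b, x⟩ ⟨h1, h2⟩ hv
      obtain rfl : b = ((x + 1 : ℕ) : ℕ∞) := hv
      have := clt.1 (AR_pos h1)
      simp only at h2
      omega
  · exact ⟨(((0 + 1 : ℕ) : ℕ∞), 0), ⟨(⊤, 0), Or.inl rfl, r0top⟩, vN' 0⟩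
  · intro w _ hw
    obtain ⟨a, t⟩ := w
    obtain rfl : a = ((t + 1 : ℕ) : ℕ∞) := hw
    refine ⟨lab t, vL t t, ?_, ?_⟩
    · cases t with
      | zero =>
        refine Or.inl ⟨hz, ?_⟩
        rintro ⟨b, x⟩ hy ⟨c, x'⟩ ⟨h1, h2⟩ hz'
        rw [eqR_prod] at hy
        simp only at hy
        subst hy
        obtain rfl : c = ((x' + 1 : ℕ) : ℕ∞) := hz'
        have := clt.1 (AR_pos h1)
        omega
      | succ k =>
        refine Or.inr ⟨(((k + 1 + 1 : ℕ) : ℕ∞), k), ⟨rfl, by simp⟩, ⟨(((k + 1 : ℕ) : ℕ∞), k), r0 (by omega), vN' k, ?_, lab k, vL k k, (hs k).symm⟩, ?_⟩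
        · rw [vP, vP]; exact (by rw [Nat.even_add_one]; tauto)
        · rintro ⟨b, x⟩ ⟨h1, h2⟩ ⟨c, x'⟩ ⟨h3, h4⟩ hz'
          obtain rfl : c = ((x' + 1 : ℕ) : ℕ∞) := hz'
          simp only at h1 h2 h3 h4
          have h1' := AR_pos h1
          subst h2 h4
          rcases h3 with h3 | ⟨-, -, h3⟩
          · have h5 := Order.add_one_le_of_lt h3
            have h6 := lt_of_le_of_lt h5 h1'
            have : (((k + 1 : ℕ) : ℕ∞) + 1) = ((k + 1 + 1 : ℕ) : ℕ∞) := by push_cast; rfl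
            rw [this] at h6
            exact lt_irrefl _ h6
          · exact absurd h3 (by simp)
    · cases ho : (lab t).2.1 with
      | inc i => trivial
      | nop => trivial
      | dec i =>
        have := hμ1 t i ho
        exact ⟨(((t + 1 : ℕ) : ℕ∞), μ t), ⟨rfl, by simp only; omega⟩, t, i, rfl, ho, rfl⟩
      | zero i =>
        rintro ⟨b, x⟩ ⟨h1, h2⟩ ⟨⟨c, x'⟩, ⟨h3, h4⟩, hz', y, hy, hyi⟩
        obtain rfl : c = ((x' + 1 : ℕ) : ℕ∞) := hz'
        simp only at h1 h2 h3 h4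
        subst h1 h4
        have hlt := clt.1 (AR_pos h3)
        rw [vLu _ _ _ hy] at hyi
        obtain ⟨t', h5, h6, h7⟩ := hμ3 t i x ho hlt hyi
        exact ⟨(((t' + 1 : ℕ) : ℕ∞), x), r0 h5, t', i, rfl, h6, h7.symm⟩
  · rintro ⟨a, x⟩ _ ⟨t, i, h1, ht, h2⟩
    simp only at h1 h2
    subst h1 h2
    have hm := hμ1 t i ht
    refine ⟨?_, ?_, i, ?_, ?_⟩
    · rintro ⟨b, y⟩ ⟨h1, h2⟩ ⟨t', i', h3, h4, h5⟩
      simp only at h1 h2 h3 h5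
      subst h1
      rw [cinj h3] at h2
      exact h2 h5.symm
    · rintro ⟨b, y⟩ ⟨h1, h2⟩ ⟨t', i', h3, h4, h5⟩
      simp only at h1 h2 h3 h5
      subst h3
      have hlt := clt.1 (AR_pos h1)
      have hm' := hμ1 t' i' h4
      have e1 : μ t = μ t' := by omega
      have : i = i' := by
        have h6 := hm.2
        rw [e1, hm'.2] at h6
        cases h6; rfl
      subst this
      have := hμ2 t t' i ht h4 e1
      omega
    · exact ⟨(((t + 1 : ℕ) : ℕ∞), t), ⟨rfl, by simp only; omega⟩, vN' t, lab t, vL t t, ht⟩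
    · exact ⟨(((μ t + 1 : ℕ) : ℕ∞), μ t), r0 hm.1, vN' _, lab (μ t), vL _ _, hm.2⟩
  · rintro ⟨b, x⟩ hb _
    rw [eqR_prod] at hb
    simp only at hb
    subst hb
    obtain ⟨t', h1, h2⟩ := hinf x
    exact ⟨(((t' + 1 : ℕ) : ℕ∞), x), r0top, ⟨(((x + 1 : ℕ) : ℕ∞), x), r0 h1, vN' x⟩,
      (((t' + 1 : ℕ) : ℕ∞), t'), ⟨rfl, by simp only; omega⟩, vN' t', lab t', vL _ _, h2⟩
  · intro w _ hw
    obtain ⟨a, t⟩ := w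
    obtain rfl : a = ((t + 1 : ℕ) : ℕ∞) := hw
    refine ⟨((0 : ℕ∞), t), ⟨Or.inl (by simp), rfl⟩, ?_⟩
    rintro ⟨b, y⟩ hb
    rw [eqR_prod] at hb
    simp only at hb
    subst hb
    refine ⟨fun h => h0ne _ ((vN _).1 h), ?_⟩
    rintro ⟨c, z⟩ ⟨h1, h2⟩ h
    have h3 := (vN _).1 h
    simp only at h1 h3
    rcases h1 with h1 | ⟨-, -, h1⟩
    · simp at h1
    · rw [h1] at h3; exact h0ne _ h3
  · intro w _ hw hl
    obtain ⟨a, t⟩ := w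
    obtain rfl : a = ((t + 1 : ℕ) : ℕ∞) := hw
    have htn := hn t (vLu _ _ _ hl).symm
    have hH : ∀ k t x, HsS (prodR0 (AR s)) (prodR1 (fun a b : ℕ => a ≠ b)) (val 0) k (((t + 1 : ℕ) : ℕ∞), x) ↔ k ≤ t := by
      intro k
      induction k with
      | zero => intro t x; simp [HsS]
      | succ k ih =>
        intro t x
        constructor
        · rintro ⟨⟨b, y⟩, ⟨h1, h2⟩, ⟨⟨c, z⟩, h3, h4⟩, h5⟩
          rw [eqR_prod] at h3
          obtain rfl : c = ((z + 1 : ℕ) : ℕ∞) := h4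
          simp only at h1 h2 h3
          subst h3
          have := clt.1 (AR_pos h1)
          have := (ih _ _).1 h5
          omega
        · intro hk
          exact ⟨_, r0 (show t - 1 < t by omega), ⟨(_, t - 1), eqR_prod.2 rfl, vN' (t - 1)⟩, (ih _ _).2 (by omega)⟩
    rw [hH, hH]
    omega

/-! ## The horizontal frame validates the logics -/

theorem AR_wf_noeth : IsLin (AR False) ∧ Noetherian (AR False) := by
  refine ⟨⟨fun x h => ?_, fun x y z h h' => ?_, fun x y => ?_⟩, ?_⟩
  · simp [AR] at h
  · simp only [AR, false_and, or_false] at *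
    exact h'.trans h
  · simp only [AR, false_and, or_false]
    rcases lt_trichotomy x y with h | h | h
    · exact Or.inr (Or.inr h)
    · exact Or.inr (Or.inl h)
    · exact Or.inl h
  · rintro ⟨x, h1, -⟩
    simp only [AR, false_and, or_false] at h1
    have := wellFounded_iff_isEmpty_descending_chain.1 (wellFounded_lt (α := ℕ∞))
    exact this.false ⟨x, h1⟩

theorem AR_trans (s : Prop) {a b c : ℕ∞} (h : AR s a b) (h' : AR s b c) : AR s a c := by
  rcases h with h | ⟨hs, rfl, rfl⟩
  · rcases h' with h' | ⟨_, rfl, rfl⟩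
    · exact Or.inl (h'.trans h)
    · exact Or.inl h
  · exact h'

/-- `T` contains witnesses for all diamonds occurring in the formula. -/
def Wit (val : ℕ → ℕ∞ → Prop) (T : Finset ℕ∞) : BForm → Prop
  | .var _ => True
  | .neg φ => Wit val T φ
  | .and φ ψ => Wit val T φ ∧ Wit val T ψ
  | .dia0 φ => Wit val T φ ∧ ∀ a b, AR True a b → BSat (AR True) (fun _ _ => False) val b φ →
      ∃ m ∈ T, AR True a m ∧ BSat (AR True) (fun _ _ => False) val m φ
  | .dia1 φ => Wit val T φ

theorem Wit.mono {val : ℕ → ℕ∞ → Prop} {T T' : Finset ℕ∞} (h : T ⊆ T') {φ : BForm} (hw : Wit val T φ) : Wit val T' φ := by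
  induction φ with
  | var _ => trivial
  | neg φ ih => exact ih hw
  | and φ ψ ih ih' => exact ⟨ih hw.1, ih' hw.2⟩
  | dia0 φ ih =>
    refine ⟨ih hw.1, fun a b h1 h2 => ?_⟩
    obtain ⟨m, h3, h4⟩ := hw.2 a b h1 h2
    exact ⟨m, h h3, h4⟩
  | dia1 φ ih => exact ih hw

theorem exists_wit (val : ℕ → ℕ∞ → Prop) (φ : BForm) : ∃ T, Wit val T φ := by
  induction φ with
  | var _ => exact ⟨∅, trivial⟩
  | neg φ ih => exact ih
  | and φ ψ ih ih' =>
    obtain ⟨T, h⟩ := ih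
    obtain ⟨T', h'⟩ := ih'
    exact ⟨T ∪ T', h.mono Finset.subset_union_left, h'.mono Finset.subset_union_right⟩
  | dia1 φ ih => exact ih
  | dia0 φ ih =>
    obtain ⟨T, h⟩ := ih
    by_cases hex : ∃ b, BSat (AR True) (fun _ _ => False) val b φ
    · let S : Set ℕ∞ := {b | BSat (AR True) (fun _ _ => False) val b φ}
      let m := wellFounded_lt.min S hex
      refine ⟨insert m T, h.mono (Finset.subset_insert _ _), fun a b h1 h2 => ⟨m, Finset.mem_insert_self _ _, ?_, wellFounded_lt.min_mem S hex⟩⟩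
      have hle : m ≤ b := not_lt.1 (wellFounded_lt.not_lt_min S h2)
      rcases h1 with h1 | ⟨_, rfl, rfl⟩
      · exact Or.inl (lt_of_le_of_lt hle h1)
      · exact Or.inr ⟨trivial, rfl, le_antisymm hle (zero_le)⟩
    · exact ⟨T, h, fun a b _ h2 => absurd ⟨b, h2⟩ hex⟩

theorem AR_omega : ∀ ψ ∈ LogOmega, UValid0 (AR True) ψ := by
  rintro φ ⟨ho, hv⟩ val w
  by_contra hcon
  obtain ⟨T, hT⟩ := exists_wit val φ
  let nxt : ℕ∞ → ℕ∞ := fun a => (T.filter fun m => m < a).sup id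
  have hnx : ∀ a, AR True a (nxt a) := by
    intro a
    by_cases ha : a = 0
    · subst ha
      exact Or.inr ⟨trivial, rfl, by simp [nxt]⟩
    · left
      rw [Finset.sup_lt_iff (by simpa using pos_iff_ne_zero.2 ha)]
      intro b hb
      exact (Finset.mem_filter.1 hb).2
  let f : ℕ → ℕ∞ := fun k => nxt^[k] w
  have fs : ∀ k, f (k + 1) = nxt (f k) := fun k => Function.iterate_succ_apply' nxt k w
  have hf1' : ∀ k i, AR True (f k) (f (k + i + 1)) := by
    intro k i
    induction i with
    | zero => rw [add_zero, fs]; exact hnx _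
    | succ i ih => rw [fs]; exact AR_trans _ ih (hnx _)
  have hf1 : ∀ k l, k < l → AR True (f k) (f l) := by
    intro k l h
    have := hf1' k (l - k - 1)
    rwa [show k + (l - k - 1) + 1 = l by omega] at this
  have hf2 : ∀ a k, f k = a → ∀ m ∈ T, AR True a m → ∃ l, k < l ∧ f l = m := by
    intro a
    induction a using (wellFounded_lt (α := ℕ∞)).induction with
    | _ a ih =>
      intro k hk m hm h
      rcases h with h | ⟨-, rfl, rfl⟩
      · have h1 : m ≤ nxt a := Finset.le_sup (f := id) (Finset.mem_filter.2 ⟨hm, h⟩)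
        rcases h1.eq_or_lt with h2 | h2
        · exact ⟨k + 1, by omega, by rw [fs, hk, h2]⟩
        · have h3 : nxt a < a := by
            rcases hnx a with h3 | ⟨-, h3, -⟩
            · exact h3
            · rw [h3] at h; simp at h
          obtain ⟨l, h4, h5⟩ := ih (nxt a) h3 (k + 1) (by rw [fs, hk]) m hm (Or.inl h2)
          exact ⟨l, by omega, h5⟩
      · refine ⟨k + 1, by omega, ?_⟩
        rw [fs, hk]; simp [nxt]
  have key : ∀ ψ : BForm, ψ.OnlyDia0 → Wit val T ψ → ∀ k,
      (BSat (fun m n : ℕ => m < n) (fun _ _ => False) (fun j k => val j (f k)) k ψ ↔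
        BSat (AR True) (fun _ _ => False) val (f k) ψ) := by
    intro ψ
    induction ψ with
    | var j => intro _ _ k; exact Iff.rfl
    | neg ψ ih => intro h1 h2 k; exact not_congr (ih h1 h2 k)
    | and ψ χ ih ih' => intro h1 h2 k; exact and_congr (ih h1.1 h2.1 k) (ih' h1.2 h2.2 k)
    | dia1 ψ ih => intro h1; exact h1.elim
    | dia0 ψ ih =>
      intro h1 h2 k
      constructor
      · rintro ⟨l, h3, h4⟩
        exact ⟨f l, hf1 _ _ h3, (ih h1 h2.1 l).1 h4⟩
      · rintro ⟨b, h3, h4⟩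
        obtain ⟨m, h5, h6, h7⟩ := h2.2 _ _ h3 h4
        obtain ⟨l, h8, h9⟩ := hf2 _ k rfl m h5 h6
        exact ⟨l, h8, (ih h1 h2.1 l).2 (h9 ▸ h7)⟩
  exact hcon ((key φ ho hT 0).1 (hv _ 0))

theorem exists_AR (L1 : Set BForm) (h1 : L1 = LogOmega ∨ L1 = GL3 ∨ L1 = DisK43) :
    ∃ s, ∀ ψ ∈ L1, UValid0 (AR s) ψ := by
  rcases h1 with rfl | rfl | rfl
  · exact ⟨True, AR_omega⟩
  · exact ⟨False, fun ψ h => h.2 _ _ ⟨0⟩ AR_wf_noeth.1 AR_wf_noeth.2⟩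
  · exact ⟨False, fun ψ h => (disK43_sub GL3 (Or.inr (Or.inl rfl)) h).2 _ _ ⟨0⟩ AR_wf_noeth.1 AR_wf_noeth.2⟩

theorem sigma11_hard_core (L1 : Set BForm)
    (h1 : L1 = LogOmega ∨ L1 = GL3 ∨ L1 = DisK43)
    (L : Set BForm) (hKC : KripkeComplete L)
    (hlo : Commutator L1 DiffLogic ⊆ L) (hhi : L ⊆ ProdLogic L1 DiffLogic) :
    Sigma11Hard (BCodes (LSat L)) := by
  intro B hB
  obtain ⟨M, e, g, hg, hB⟩ := sigma11_machine B hB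
  obtain ⟨C, rfl⟩ := hKC
  refine ⟨fun n => encodeB (mainF M e (g n)), (computable_form M e).comp hg, fun n => ?_⟩
  have hc : BCodes (LSat (LogOf C)) (encodeB (mainF M e (g n))) ↔ LSat (LogOf C) (mainF M e (g n)) := by
    constructor
    · rintro ⟨φ, h, h'⟩
      rwa [encodeB_inj _ _ h] at h'
    · exact fun h => ⟨_, rfl, h⟩
  rw [hc, hB]
  have hsat : ∀ φ, BForm.neg φ ∉ LogOf C → ∃ F, C F ∧ ∃ val w, BSat F.R0 F.R1 val w φ := by
    intro φ h
    simp only [LogOf, Set.mem_setOf_eq, Frame2.Valid, sat_neg] at h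
    push Not at h
    exact h
  constructor
  · intro hrun
    obtain ⟨s, hs⟩ := exists_AR L1 h1
    obtain ⟨val, w, hw⟩ := complete s hrun
    have hnot : BForm.neg (mainF M e (g n)) ∉ LogOf C := by
      intro h
      exact hhi h ℕ∞ ℕ ⟨0⟩ ⟨0⟩ (AR s) (fun a b => a ≠ b) hs (fun ψ hψ => hψ.2 ℕ ⟨0⟩) val w hw
    obtain ⟨F, hF, val, w, hw⟩ := hsat _ hnot
    exact ⟨F.W, F.ne, F.R0, F.R1, val, fun ψ hψ w => hψ F hF val w, w, hw⟩
  · rintro ⟨W, _, R0, R1, val, hL, w, hw⟩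
    have hnot : BForm.neg (mainF M e (g n)) ∉ LogOf C := fun h => hL _ h w hw
    obtain ⟨F, hF, val, w, hw⟩ := hsat _ hnot
    have hc : ∀ φ, (∀ L' : Set BForm, (IsLogic L' ∧ L1 ⊆ L' ∧ DiffLogic ⊆ L' ∧
        commAx1 ∈ L' ∧ commAx2 ∈ L' ∧ commAx3 ∈ L') → φ ∈ L') → F.Valid φ :=
      fun φ h => hlo (Set.mem_sInter.2 h) F hF
    have hFP := frameProps F
      (fun φ hφ => hc φ fun L' h => h.2.1 (disK43_sub L1 h1 hφ))
      (fun φ hφ => hc φ fun L' h => h.2.2.1 hφ)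
      (hc _ fun L' h => h.2.2.2.1) (hc _ fun L' h => h.2.2.2.2.1) (hc _ fun L' h => h.2.2.2.2.2)
    rw [sat_mainF] at hw
    exact Ctx.sound ⟨hFP, hw, fun w x y h h' => h.uniq h'⟩ (fun w x h => h.mem)

/-- For `L₁` any of `Log⟨ω,<⟩`, `GL.3`, `DisK4.3` and any Kripke
complete bimodal logic `L` with `[L₁,Diff] ⊆ L ⊆ L₁×Diff`, the `L`-satisfiability
problem is `Σ₁¹`-hard. -/
theorem interval_logics_Sigma11_hard (L1 : Set BForm)
    (h1 : L1 = LogOmega ∨ L1 = GL3 ∨ L1 = DisK43)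
    (L : Set BForm) (hKC : KripkeComplete L)
    (hlo : Commutator L1 DiffLogic ⊆ L) (hhi : L ⊆ ProdLogic L1 DiffLogic) :
    Sigma11Hard (BCodes (LSat L)) := by
  exact sigma11_hard_core L1 h1 L hKC hlo hhi

end HK
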